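/- Assume the affine G-variety X is normal and connected, G is generated by elements having a fixed point in X, and there exists a separating set of invariants of size n + k - 1 where n = dim(X) and k ≥ 1 (i.e., γ_sep = n + k - 1). Then G is generated by k-reflections on X. -/

import Mathlib

noncomputable section

open TensorProduct PrimeSpectrum

section Defs

variable (K R G : Type*) [Field K] [CommRing R] [Algebra K R] [Group G]

/-- The subalgebra of `G`-invariant regular functions. -/
def invariantsAlg (φ : G →* (R ≃ₐ[K] R)) : Subalgebra K R where
  carrier := {f | ∀ σ : G, φ σ f = f}
  mul_mem' := fun {a b} ha hb σ => by rw [map_mul, ha σ, hb σ]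
  add_mem' := fun {a b} ha hb σ => by rw [map_add, ha σ, hb σ]
  algebraMap_mem' := fun r σ => (φ σ).commutes r

/-- δ(f) = f ⊗ 1 - 1 ⊗ f. -/
def deltaMap (f : R) : R ⊗[K] R := f ⊗ₜ[K] (1 : R) - (1 : R) ⊗ₜ[K] f

def sepIdeal (φ : G →* (R ≃ₐ[K] R)) : Ideal (R ⊗[K] R) :=
  Ideal.span (deltaMap K R '' (invariantsAlg K R G φ : Set R))

/-- The separating variety, as a closed subset of Spec (K[X] ⊗ K[X]). -/
def sepVariety (φ : G →* (R ≃ₐ[K] R)) : Set (PrimeSpectrum (R ⊗[K] R)) :=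
  zeroLocus (sepIdeal K R G φ : Set (R ⊗[K] R))

/-- The ideal I_σ generated by all σ·f - f. -/
def reflIdeal (φ : G →* (R ≃ₐ[K] R)) (σ : G) : Ideal R :=
  Ideal.span (Set.range fun f : R => φ σ f - f)

/-- Codimension of a subset `Z` inside a subset `S` of a prime spectrum:
the infimum of the heights (within `S`) of points of `Z`. -/
def codimIn {A : Type*} [CommRing A] (S Z : Set (PrimeSpectrum A)) : ℕ∞ :=
  ⨅ p : {q : S // (q : PrimeSpectrum A) ∈ Z}, Order.height (p : S)

/-- σ is a k-reflection: its fixed subvariety has codimension at most k. -/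
def IsKReflection (φ : G →* (R ≃ₐ[K] R)) (k : ℕ∞) (σ : G) : Prop :=
  codimIn (Set.univ) (zeroLocus (reflIdeal K R G φ σ : Set R)) ≤ k

/-- A subset `S` of a prime spectrum is connected in codimension `k`. -/
def ConnectedInCodim {A : Type*} [CommRing A] (S : Set (PrimeSpectrum A)) (k : ℕ∞) : Prop :=
  ∀ Z : Set (PrimeSpectrum A), (∃ C, IsClosed C ∧ Z = S ∩ C) → k < codimIn S Z →
    IsConnected (S \ Z)

/-- A separating set of invariants. -/
def IsSeparating (φ : G →* (R ≃ₐ[K] R)) (S : Set R) : Prop :=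
  S ⊆ (invariantsAlg K R G φ : Set R) ∧
  ∀ x y : R →ₐ[K] K, (∃ f ∈ invariantsAlg K R G φ, x f ≠ y f) → ∃ g ∈ S, x g ≠ y g

/-- The minimal size of a separating set of invariants. -/
def gammaSep (φ : G →* (R ≃ₐ[K] R)) : ℕ∞ :=
  ⨅ S ∈ {S : Set R | IsSeparating K R G φ S}, S.encard

/-- σ has a fixed (geometric) point. -/
def HasFixedPoint (φ : G →* (R ≃ₐ[K] R)) (σ : G) : Prop :=
  ∃ x : R →ₐ[K] K, ∀ f : R, x (φ σ f) = x f

/-- The component H_{σ,i} = {(x, σ x) : x ∈ X_i} of the separating variety,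
for a (minimal) prime p of K[X]. -/
def graphComp (φ : G →* (R ≃ₐ[K] R)) (σ : G) (p : Ideal R) :
    Set (PrimeSpectrum (R ⊗[K] R)) :=
  zeroLocus ((Ideal.comap
    (Algebra.TensorProduct.productMap (AlgHom.id K R) (φ σ⁻¹).toAlgHom) p : Ideal (R ⊗[K] R)) :
      Set (R ⊗[K] R))

/-- The depth of a Noetherian local ring: supremum of lengths of regular sequences
in the maximal ideal. -/
def localDepth (A : Type*) [CommRing A] [IsLocalRing A] : ℕ∞ :=
  sSup {n : ℕ∞ | ∃ rs : List A, (rs.length : ℕ∞) = n ∧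
    (∀ r ∈ rs, r ∈ IsLocalRing.maximalIdeal A) ∧ RingTheory.Sequence.IsRegular A rs}

/-- The Cohen-Macaulay defect of `A` is at most `k`. -/
def cmdefLE (A : Type*) [CommRing A] (k : ℕ∞) : Prop :=
  ∀ p : PrimeSpectrum A, ringKrullDim (Localization.AtPrime p.asIdeal) ≤
    ((localDepth (Localization.AtPrime p.asIdeal) + k : ℕ∞) : WithBot ℕ∞)

/-- The height of an ideal. -/
def idealHeight {A : Type*} [CommRing A] (I : Ideal A) : ℕ∞ :=
  ⨅ p : {q : PrimeSpectrum A // I ≤ q.asIdeal}, Order.height (p : PrimeSpectrum A)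



namespace GK
section P1
open Polynomial MvPolynomial Ideal Nat RingHom List

variable {k : Type*} [Field k] {n : ℕ} (f : MvPolynomial (Fin (n + 1)) k)
variable (v w : Fin (n + 1) →₀ ℕ)

abbrev up : ℕ := 2 + f.totalDegree

abbrev rr (i : Fin (n + 1)) : ℕ := up f ^ i.1

lemma lt_up {f : MvPolynomial (Fin (n + 1)) k} {v : Fin (n + 1) →₀ ℕ}
    (vlt : ∀ i, v i < up f) : ∀ l ∈ ofFn v, l < up f := by
  grind

abbrev T1 (c : k) :
    MvPolynomial (Fin (n + 1)) k →ₐ[k] MvPolynomial (Fin (n + 1)) k :=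
  aeval fun i ↦ if i = 0 then X 0 else X i + c • X 0 ^ rr f i

lemma t1_comp_t1_neg (c : k) : (T1 f c).comp (T1 f (-c)) = AlgHom.id _ _ := by
  rw [comp_aeval, ← MvPolynomial.aeval_X_left]
  ext i v
  cases i using Fin.cases <;> simp

abbrev T := AlgEquiv.ofAlgHom (T1 f 1) (T1 f (-1))
  (t1_comp_t1_neg f 1) (by simpa using t1_comp_t1_neg f (-1))

lemma sum_r_mul_ne (vlt : ∀ i, v i < up f) (wlt : ∀ i, w i < up f) (ne : v ≠ w) :
    ∑ x : Fin (n + 1), rr f x * v x ≠ ∑ x : Fin (n + 1), rr f x * w x := by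
  intro h
  refine ne <| Finsupp.ext <| congrFun <| ofFn_inj.mp ?_
  apply ofDigits_inj_of_len_eq (Nat.lt_add_right f.totalDegree one_lt_two)
    (by simp) (lt_up vlt) (lt_up wlt)
  simpa only [ofDigits_eq_sum_mapIdx, mapIdx_eq_ofFn, get_ofFn, length_ofFn,
    Fin.val_cast, mul_comm, sum_ofFn] using! h

lemma degreeOf_zero_t {a : k} (ha : a ≠ 0) : ((T f) (monomial v a)).degreeOf 0 =
    ∑ i : Fin (n + 1), (rr f i) * v i := by
  rw [← natDegree_finSuccEquiv, monomial_eq, Finsupp.prod_pow v fun a ↦ X a]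
  simp only [Fin.prod_univ_succ, Fin.sum_univ_succ, map_mul, map_prod, map_pow,
    AlgEquiv.ofAlgHom_apply, MvPolynomial.aeval_C, MvPolynomial.aeval_X, if_pos, Fin.succ_ne_zero,
    ite_false, one_smul, map_add, finSuccEquiv_X_zero, finSuccEquiv_X_succ, algebraMap_eq]
  have h (i : Fin n) :
      (Polynomial.C (X (R := k) i) + Polynomial.X ^ rr f i.succ) ^ v i.succ ≠ 0 :=
    pow_ne_zero (v i.succ) (leadingCoeff_ne_zero.mp <| by simp [add_comm, leadingCoeff_X_pow_add_C])
  rw [natDegree_mul (by simp [ha]) (mul_ne_zero (by simp) (Finset.prod_ne_zero_iff.mpr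
    (fun i _ ↦ h i))), natDegree_mul (by simp) (Finset.prod_ne_zero_iff.mpr (fun i _ ↦ h i)),
    natDegree_prod _ _ (fun i _ ↦ h i), natDegree_finSuccEquiv, degreeOf_C]
  simp only [natDegree_pow, zero_add, natDegree_X, mul_one]
  have h0 : rr f 0 = 1 := by simp [rr]
  rw [h0, one_mul, add_right_inj]
  exact Finset.sum_congr rfl (fun i _ ↦ by
    rw [add_comm (Polynomial.C _), natDegree_X_pow_add_C, mul_comm])

lemma degreeOf_t_ne_of_ne (hv : v ∈ f.support) (hw : w ∈ f.support) (ne : v ≠ w) :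
    (T f <| monomial v <| coeff v f).degreeOf 0 ≠
    (T f <| monomial w <| coeff w f).degreeOf 0 := by
  rw [degreeOf_zero_t _ _ <| mem_support_iff.mp hv, degreeOf_zero_t _ _ <| mem_support_iff.mp hw]
  refine sum_r_mul_ne f v w (fun i ↦ ?_) (fun i ↦ ?_) ne <;>
  exact lt_of_le_of_lt ((monomial_le_degreeOf i ‹_›).trans (degreeOf_le_totalDegree f i))
    (by lia)

lemma leadingCoeff_finSuccEquiv_t :
    (finSuccEquiv k n ((T f) ((monomial v) (coeff v f)))).leadingCoeff =
    algebraMap k _ (coeff v f) := by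
  rw [monomial_eq, Finsupp.prod_fintype]
  · simp only [map_mul, map_prod, leadingCoeff_mul, leadingCoeff_prod]
    rw [AlgEquiv.ofAlgHom_apply, algHom_C, algebraMap_eq, finSuccEquiv_apply,
      eval₂Hom_C, coe_comp]
    simp only [AlgEquiv.ofAlgHom_apply, Function.comp_apply, leadingCoeff_C, map_pow,
      leadingCoeff_pow, algebraMap_eq]
    have : ∀ j, ((finSuccEquiv k n) ((T1 f) 1 (X j))).leadingCoeff = 1 := fun j ↦ by
      by_cases h : j = 0
      · simp [h, finSuccEquiv_apply]
      · simp only [aeval_eq_bind₁, bind₁_X_right, if_neg h, one_smul, map_add, map_pow]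
        obtain ⟨i, rfl⟩ := Fin.exists_succ_eq.mpr h
        simp [finSuccEquiv_X_succ, finSuccEquiv_X_zero, add_comm]
    simp only [this, one_pow, Finset.prod_const_one, mul_one]
  exact fun i ↦ pow_zero _

lemma T_leadingcoeff_isUnit (fne : f ≠ 0) :
    IsUnit (finSuccEquiv k n (T f f)).leadingCoeff := by
  obtain ⟨v, vin, vs⟩ := Finset.exists_max_image f.support
    (fun v ↦ (T f ((monomial v) (coeff v f))).degreeOf 0) (support_nonempty.mpr fne)
  set h := fun w ↦ (MvPolynomial.monomial w) (coeff w f)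
  simp only [← natDegree_finSuccEquiv] at vs
  replace vs : ∀ x ∈ f.support \ {v}, (finSuccEquiv k n ((T f) (h x))).degree <
      (finSuccEquiv k n ((T f) (h v))).degree := by
    intro x hx
    obtain ⟨h1, h2⟩ := Finset.mem_sdiff.mp hx
    apply degree_lt_degree <| lt_of_le_of_ne (vs x h1) ?_
    simpa only [natDegree_finSuccEquiv]
      using degreeOf_t_ne_of_ne f _ _ h1 vin <| ne_of_not_mem_cons h2
  have coeff : (finSuccEquiv k n ((T f) (h v + ∑ x ∈ f.support \ {v}, h x))).leadingCoeff =
      (finSuccEquiv k n ((T f) (h v))).leadingCoeff := by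
    simp only [map_add, map_sum]
    rw [add_comm]
    apply leadingCoeff_add_of_degree_lt <| (lt_of_le_of_lt <| degree_sum_le _ _) ?_
    have h2 : h v ≠ 0 := by simpa [h] using mem_support_iff.mp vin
    replace h2 : (finSuccEquiv k n ((T f) (h v))) ≠ 0 := fun eq ↦ h2 <|
      by simpa only [map_eq_zero_iff _ (AlgEquiv.injective _)] using eq
    exact (Finset.sup_lt_iff <| Ne.bot_lt (fun x ↦ h2 <| degree_eq_bot.mp x)).mpr vs
  nth_rw 2 [← f.support_sum_monomial_coeff]
  rw [Finset.sum_eq_add_sum_sdiff_singleton_of_mem vin h]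
  rw [leadingCoeff_finSuccEquiv_t] at coeff
  simpa only [coeff, algebraMap_eq] using (mem_support_iff.mp vin).isUnit.map MvPolynomial.C

theorem exists_coord (fne : f ≠ 0) :
    ∃ e : MvPolynomial (Fin (n + 1)) k ≃ₐ[k] (MvPolynomial (Fin n) k)[X],
      IsUnit (e f).leadingCoeff :=
  ⟨(T f).trans (finSuccEquiv k n), T_leadingcoeff_isUnit f fne⟩

end P1
end GK

namespace GK
section P2
open Cardinal

/-- transcendence degree as a natural number -/
def td (K D : Type*) [Field K] [CommRing D] [Algebra K D] : ℕ := Cardinal.toNat (Algebra.trdeg K D)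

lemma td_eq_of_algebraic (K : Type*) {D D' : Type*} [Field K] [CommRing D] [CommRing D'] [IsDomain D']
    [Algebra K D] [Algebra K D'] [Algebra D D'] [IsScalarTower K D D'] [Algebra.IsAlgebraic D D']
    [FaithfulSMul D D'] : td K D = td K D' := by
  have hinj : Function.Injective (algebraMap D D') := FaithfulSMul.algebraMap_injective D D'
  have := hinj.isDomain
  have h := lift_trdeg_add_eq K D (A := D')
  rw [trdeg_eq_zero (R := D) (A := D')] at h
  have h2 := congrArg Cardinal.toNat h
  simpa [td] using h2

lemma td_eq_of_isIntegral {K : Type*} {D D' : Type*} [Field K] [CommRing D] [CommRing D'] [IsDomain D']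
    [Algebra K D] [Algebra K D'] (f : D →ₐ[K] D') (hf : Function.Injective f)
    (hi : f.toRingHom.IsIntegral) : td K D = td K D' := by
  algebraize [f.toRingHom]
  have := hf.isDomain
  have : FaithfulSMul D D' := (faithfulSMul_iff_algebraMap_injective D D').mpr hf
  exact td_eq_of_algebraic K

lemma td_mvPolynomial (K : Type*) [Field K] (m : ℕ) : td K (MvPolynomial (Fin m) K) = m := by
  simp [td, MvPolynomial.trdeg_of_isDomain]

lemma td_congr {K D D' : Type*} [Field K] [CommRing D] [CommRing D']
    [Algebra K D] [Algebra K D'] (e : D ≃ₐ[K] D') : td K D = td K D' := by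
  have h2 := congrArg Cardinal.toNat e.lift_trdeg_eq
  simpa [td] using h2

lemma td_le_of_surjective {K D D' : Type*} [Field K] [CommRing D] [CommRing D']
    [Algebra K D] [Algebra K D'] (hfin : Algebra.trdeg K D < ℵ₀) (e : D →ₐ[K] D') (he : Function.Surjective e) :
    td K D' ≤ td K D := by
  have h2 := Cardinal.toNat_le_toNat (lift_trdeg_le_of_surjective e he) (by simpa using hfin)
  simpa [td] using h2

lemma td_le_of_injective {K D D' : Type*} [Field K] [CommRing D] [CommRing D']
    [Algebra K D] [Algebra K D'] (hfin : Algebra.trdeg K D' < ℵ₀) (e : D →ₐ[K] D') (he : Function.Injective e) :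
    td K D ≤ td K D' := by
  have h2 := Cardinal.toNat_le_toNat (lift_trdeg_le_of_injective e he) (by simpa using hfin)
  simpa [td] using h2

lemma trdeg_lt (K D : Type*) [Field K] [CommRing D] [Algebra K D] [Algebra.FiniteType K D] :
    Algebra.trdeg K D < ℵ₀ := trdeg_lt_aleph0_of_finiteType ..

/-- L1 consequence: quotient by something containing u≠0. There is Q' → Q with Q/(u) integral over Q'.-/
lemma exists_integral_of_mem {K : Type*} [Field K] {m : ℕ} (I : Ideal (MvPolynomial (Fin (m+1)) K))
    (u : MvPolynomial (Fin (m+1)) K) (hu : u ≠ 0) (huI : u ∈ I) :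
    ∃ g : MvPolynomial (Fin m) K →ₐ[K] (MvPolynomial (Fin (m+1)) K ⧸ I), g.toRingHom.IsIntegral := by
  obtain ⟨e, he⟩ := exists_coord u hu
  let c : MvPolynomial (Fin m) K →ₐ[K] Polynomial (MvPolynomial (Fin m) K) := Polynomial.CAlgHom
  let g : MvPolynomial (Fin m) K →ₐ[K] (MvPolynomial (Fin (m+1)) K ⧸ I) :=
    (Ideal.Quotient.mkₐ K I).comp ((e.symm : _ →ₐ[K] _).comp c)
  refine ⟨g, ?_⟩
  -- root of monic
  let p := e u
  obtain ⟨lc, hlc⟩ := he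
  have hp : (Polynomial.C (↑lc⁻¹ : MvPolynomial (Fin m) K) * p).Monic := by
    unfold Polynomial.Monic
    rw [Polynomial.leadingCoeff_C_mul_of_isUnit (Units.isUnit _), ← hlc]
    simp
  let mk : Polynomial (MvPolynomial (Fin m) K) →+* (MvPolynomial (Fin (m+1)) K ⧸ I) :=
    (Ideal.Quotient.mk I).comp e.symm.toRingEquiv.toRingHom
  have hmk : Function.Surjective mk := Ideal.Quotient.mk_surjective.comp e.symm.surjective
  have hX : g.toRingHom.IsIntegralElem (mk Polynomial.X) := by
    refine ⟨_, hp, ?_⟩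
    have : ∀ q : Polynomial (MvPolynomial (Fin m) K), q.eval₂ g.toRingHom (mk Polynomial.X) = mk q := by
      intro q
      have : (Polynomial.eval₂RingHom g.toRingHom (mk Polynomial.X)) = mk := by
        ext <;> simp [g, mk, c] 
      exact DFunLike.congr_fun this q
    rw [this]
    simp only [p, mk, RingHom.comp_apply, map_mul]
    convert mul_zero _
    rw [Ideal.Quotient.eq_zero_iff_mem]
    simpa using huI
  intro x
  obtain ⟨q, rfl⟩ := hmk x
  induction q using Polynomial.induction_on' with
  | add a b ha hb => rw [map_add]; exact ha.add g.toRingHom hb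
  | monomial k a =>
    rw [← Polynomial.C_mul_X_pow_eq_monomial, map_mul, map_pow]
    refine RingHom.IsIntegralElem.mul _ ?_ ?_
    · exact RingHom.isIntegralElem_map g.toRingHom (x := a)
    · algebraize [g.toRingHom]
      exact IsIntegral.pow hX k

lemma td_quotient_lt {K : Type*} [Field K] {m : ℕ} (P : Ideal (MvPolynomial (Fin m) K)) [P.IsPrime] (hP : P ≠ ⊥) :
    td K (MvPolynomial (Fin m) K ⧸ P) < m := by
  obtain ⟨u, huP, hu⟩ := Submodule.exists_mem_ne_zero_of_ne_bot hP
  cases m with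
  | zero =>
    exfalso
    have : P = ⊤ := by
      apply Ideal.eq_top_of_isUnit_mem _ huP
      rw [MvPolynomial.eq_C_of_isEmpty u] at hu ⊢
      exact (IsUnit.mk0 _ (fun h => hu (by rw [h]; simp))).map MvPolynomial.C
    exact Ideal.IsPrime.ne_top' this
  | succ m =>
    obtain ⟨g, hg⟩ := exists_integral_of_mem P u hu huP
    have h1 : td K (MvPolynomial (Fin m) K ⧸ RingHom.ker g) = td K (MvPolynomial (Fin (m+1)) K ⧸ P) := by
      refine td_eq_of_isIntegral (Ideal.kerLiftAlg g) (Ideal.kerLiftAlg_injective g) ?_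
      refine RingHom.IsIntegral.tower_top (Ideal.Quotient.mk _) _ ?_
      exact hg
    have h2 := td_le_of_surjective (trdeg_lt K _) (Ideal.Quotient.mkₐ K (RingHom.ker g)) Ideal.Quotient.mk_surjective
    rw [td_mvPolynomial] at h2
    omega

/-- quotient by principal prime -/
lemma td_quotient_span_prime {K : Type*} [Field K] {m : ℕ} (π : MvPolynomial (Fin m) K) (hπ : Prime π) :
    td K (MvPolynomial (Fin m) K ⧸ Ideal.span {π}) + 1 = m := by
  have hpr : (Ideal.span {π}).IsPrime := (Ideal.span_singleton_prime hπ.ne_zero).mpr hπ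
  cases m with
  | zero =>
    exfalso
    have := td_quotient_lt (Ideal.span {π}) (by simpa using hπ.ne_zero)
    omega
  | succ m =>
    obtain ⟨e, he⟩ := exists_coord π hπ.ne_zero
    obtain ⟨lc, hlc⟩ := he
    let c : MvPolynomial (Fin m) K →ₐ[K] Polynomial (MvPolynomial (Fin m) K) := Polynomial.CAlgHom
    let g : MvPolynomial (Fin m) K →ₐ[K] (MvPolynomial (Fin (m+1)) K ⧸ Ideal.span {π}) :=
      (Ideal.Quotient.mkₐ K _).comp ((e.symm : _ →ₐ[K] _).comp c)
    have hπ' : (e π).natDegree ≠ 0 := by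
      intro h0
      apply hπ.not_isUnit
      have : e π = Polynomial.C ((e π).leadingCoeff) := by
        rw [Polynomial.leadingCoeff, h0]; exact Polynomial.eq_C_of_natDegree_eq_zero h0
      rw [← hlc] at this
      have h2 : IsUnit (e π) := by rw [this]; exact (Units.isUnit lc).map Polynomial.C
      simpa using h2
    have hg : Function.Injective g := by
      rw [injective_iff_map_eq_zero]
      intro a ha
      have h1 : e.symm (Polynomial.C a) ∈ Ideal.span {π} := Ideal.Quotient.eq_zero_iff_mem.mp ha
      rw [Ideal.mem_span_singleton] at h1
      have h2 : e π ∣ Polynomial.C a := by simpa using map_dvd e h1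
      by_contra ha0
      have := Polynomial.natDegree_le_of_dvd h2 (by simpa using ha0)
      simp at this; omega
    have h1 := td_le_of_injective (trdeg_lt K _) g hg
    rw [td_mvPolynomial] at h1
    have := td_quotient_lt (Ideal.span {π}) (by simpa using hπ.ne_zero)
    omega

end P2
end GK

namespace GK
section P3

def Ht2 {Q : Type*} [CommRing Q] (j : Ideal Q) : Prop := ∀ π : Q, Prime π → ¬ j ≤ Ideal.span {π}

lemma L2 {Q : Type*} [CommRing Q] [IsDomain Q] [UniqueFactorizationMonoid Q] {j : Ideal Q} (hj : Ht2 j)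
    {v c : Q} (hv : v ≠ 0) (h : ∀ t ∈ j, v ∣ t * c) : v ∣ c := by
  obtain ⟨v1, c1, g, hrel, rfl, rfl⟩ := UniqueFactorizationMonoid.exists_reduced_factors v hv c
  have hg : g ≠ 0 := fun h => hv (by simp [h])
  have h1 : ∀ t ∈ j, v1 ∣ t := by
    intro t ht
    have := h t ht
    rw [mul_left_comm] at this
    exact hrel.dvd_of_dvd_mul_right ((mul_dvd_mul_iff_left hg).mp this)
  by_cases hu : IsUnit v1
  · exact mul_dvd_mul_left _ hu.dvd
  · exfalso
    obtain ⟨π, hπ, hd⟩ := WfDvdMonoid.exists_irreducible_factor hu (fun h => hv (by simp [h]))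
    refine hj π (UniqueFactorizationMonoid.irreducible_iff_prime.mp hπ) fun t ht => ?_
    exact Ideal.mem_span_singleton.mpr (hd.trans (h1 t ht))

lemma L2F {Q F : Type*} [CommRing Q] [IsDomain Q] [UniqueFactorizationMonoid Q] [Field F] [Algebra Q F]
    [IsFractionRing Q F] {j : Ideal Q} (hj : Ht2 j) {y : F}
    (h : ∀ t ∈ j, ∃ q, algebraMap Q F q = algebraMap Q F t * y) : ∃ q, algebraMap Q F q = y := by
  obtain ⟨c, v, hv, rfl⟩ := IsFractionRing.div_surjective (A := Q) y
  have hv0 : v ≠ 0 := nonZeroDivisors.ne_zero hv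
  have hv' : algebraMap Q F v ≠ 0 := by simpa using hv0
  have : v ∣ c := by
    refine L2 hj hv0 fun t ht => ?_
    obtain ⟨q, hq⟩ := h t ht
    refine ⟨q, IsFractionRing.injective Q F ?_⟩
    rw [map_mul, map_mul, hq]; field_simp
  obtain ⟨q, rfl⟩ := this
  exact ⟨q, by rw [map_mul]; field_simp⟩

open Polynomial in
lemma L3core {Q F : Type*} [CommRing Q] [IsDomain Q] [UniqueFactorizationMonoid Q] [Field F]
    [Algebra Q[X] F] [IsFractionRing Q[X] F] {j : Ideal Q[X]} (u : Q[X]) (hu : u.Monic) (huj : u ∈ j)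
    (hj : Ht2 (j.comap C)) (v : Q) (hv : v ≠ 0) (hvj : C v ∈ j)
    (η : Q[X] → F)
    (hsmul : ∀ c, ∀ t ∈ j, ∃ q, algebraMap Q[X] F q = η (c * t) - algebraMap Q[X] F c * η t) :
    ∃ y, ∀ t ∈ j, ∃ q, algebraMap Q[X] F q = η t - algebraMap Q[X] F t * y := by
  have hinj : Function.Injective (algebraMap Q[X] F) := IsFractionRing.injective _ _
  have hu0 : algebraMap Q[X] F u ≠ 0 := by
    rw [Ne, map_eq_zero_iff _ hinj]; exact hu.ne_zero
  -- cross relation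
  have hcross : ∀ s ∈ j, ∀ t ∈ j, ∃ q, algebraMap Q[X] F q =
      algebraMap Q[X] F s * η t - algebraMap Q[X] F t * η s := by
    intro s hs t ht
    obtain ⟨q1, h1⟩ := hsmul s t ht
    obtain ⟨q2, h2⟩ := hsmul t s hs
    refine ⟨q2 - q1, ?_⟩
    rw [map_sub, h1, h2, mul_comm s t]; ring
  have hg : ∀ t, ∃ g : Q[X], t ∈ j → algebraMap Q[X] F g =
      algebraMap Q[X] F u * η t - algebraMap Q[X] F t * η u := by
    intro t
    by_cases ht : t ∈ j
    · obtain ⟨q, hq⟩ := hcross u huj t ht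
      exact ⟨q, fun _ => hq⟩
    · exact ⟨0, fun h => absurd h ht⟩
  choose g hg using hg
  have hgc : ∀ s ∈ j, ∀ t ∈ j, u ∣ s * g t - t * g s := by
    intro s hs t ht
    obtain ⟨q, hq⟩ := hcross s hs t ht
    refine ⟨q, hinj ?_⟩
    simp only [map_sub, map_mul, hg s hs, hg t ht, hq]; ring
  have hmod : ∀ (a : Q) (p : Q[X]), (C a * p) %ₘ u = C a * (p %ₘ u) := by
    intro a p
    rw [← smul_eq_C_mul, smul_modByMonic, smul_eq_C_mul]
  have hdvd : ∀ t, C t ∈ j → C t * (g (C v) %ₘ u) = C v * (g (C t) %ₘ u) := by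
    intro t ht
    rw [← hmod, ← hmod, ← sub_eq_zero, ← sub_modByMonic]
    exact (modByMonic_eq_zero_iff_dvd hu).mpr (hgc _ ht _ hvj)
  have hY : C v ∣ g (C v) %ₘ u := by
    rw [C_dvd_iff_dvd_coeff]
    intro i
    refine L2 hj hv fun t ht => ⟨(g (C t) %ₘ u).coeff i, ?_⟩
    have := congrArg (fun p => coeff p i) (hdvd t ht)
    simpa using this
  obtain ⟨Y, hY⟩ := hY
  refine ⟨η u / algebraMap Q[X] F u + algebraMap Q[X] F Y / algebraMap Q[X] F u, fun t ht => ?_⟩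
  have key : u ∣ g t - t * Y := by
    rw [← modByMonic_eq_zero_iff_dvd hu]
    have h1 : u ∣ C v * (g t - t * Y) := by
      have h2 := hgc _ hvj _ ht
      have h3 : u ∣ g (C v) - C v * Y := by
        rw [← hY]; exact ⟨g (C v) /ₘ u, by rw [sub_eq_iff_eq_add, add_comm, modByMonic_add_div]⟩
      have : C v * (g t - t * Y) = (C v * g t - t * g (C v)) + t * (g (C v) - C v * Y) := by ring
      rw [this]
      exact dvd_add h2 (h3.mul_left _)
    rw [← modByMonic_eq_zero_iff_dvd hu, hmod] at h1
    exact (mul_eq_zero.mp h1).resolve_left (by simpa using hv)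
  obtain ⟨q, hq⟩ := key
  refine ⟨q, ?_⟩
  have h1 := congrArg (algebraMap Q[X] F) hq
  rw [map_sub, map_mul, map_mul, hg t ht] at h1
  field_simp
  linear_combination -h1


lemma td_quot_comap {K D E : Type*} [Field K] [CommRing D] [CommRing E] [Algebra K D] [Algebra K E]
    (g : D →ₐ[K] E) (P : Ideal E) [P.IsPrime]
    (hg : ((Ideal.Quotient.mk P).comp g.toRingHom).IsIntegral) :
    td K (D ⧸ P.comap g) = td K (E ⧸ P) := by
  let f : (D ⧸ P.comap g) →ₐ[K] E ⧸ P := Ideal.quotientMapₐ P g le_rfl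
  refine td_eq_of_isIntegral f ?_ ?_
  · exact Ideal.quotientMap_injective' (H := le_rfl) le_rfl
  · refine RingHom.IsIntegral.tower_top (Ideal.Quotient.mk _) _ ?_
    exact hg

lemma isIntegral_mk_of_le {D E : Type*} [CommRing D] [CommRing E]
    (g : D →+* E) {j P : Ideal E} (hjP : j ≤ P) (hg : ((Ideal.Quotient.mk j).comp g).IsIntegral) :
    ((Ideal.Quotient.mk P).comp g).IsIntegral := by
  intro x
  obtain ⟨y, rfl⟩ := Ideal.Quotient.mk_surjective x
  obtain ⟨p, hp, h0⟩ := hg (Ideal.Quotient.mk j y)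
  refine ⟨p, hp, ?_⟩
  have h1 := Polynomial.hom_eval₂ p ((Ideal.Quotient.mk j).comp g) (Ideal.Quotient.factor hjP)
    (Ideal.Quotient.mk j y)
  rw [h0, map_zero] at h1
  exact h1.symm

lemma lying_over_quot {D E : Type*} [CommRing D] [CommRing E]
    (g : D →+* E) (j : Ideal E) (hg : ((Ideal.Quotient.mk j).comp g).IsIntegral)
    (p : Ideal D) [hp : p.IsPrime] (hjp : j.comap g ≤ p) :
    ∃ P : Ideal E, P.IsPrime ∧ j ≤ P ∧ P.comap g = p := by
  algebraize [(Ideal.Quotient.mk j).comp g]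
  obtain ⟨P', -, hP', hP'2⟩ := Ideal.exists_ideal_over_prime_of_isIntegral (S := E ⧸ j) p ⊥ (by
    intro x hx
    refine hjp ?_
    have h0 : Ideal.Quotient.mk j (g x) = 0 := hx
    exact (Ideal.Quotient.eq_zero_iff_mem (I := j)).mp h0)
  refine ⟨P'.comap (Ideal.Quotient.mk j), inferInstance, ?_, ?_⟩
  · intro x hx
    rw [Ideal.mem_comap, Ideal.Quotient.eq_zero_iff_mem.mpr hx]; exact P'.zero_mem
  · exact hP'2

/-- L3 over polynomial ring -/
lemma L3 {K F : Type*} [Field K] {m : ℕ} [Field F] [Algebra (MvPolynomial (Fin m) K) F]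
    [IsFractionRing (MvPolynomial (Fin m) K) F] {j : Ideal (MvPolynomial (Fin m) K)}
    (hj : ∀ P : Ideal (MvPolynomial (Fin m) K), P.IsPrime → j ≤ P →
      td K (MvPolynomial (Fin m) K ⧸ P) + 3 ≤ m)
    (η : MvPolynomial (Fin m) K → F)
    (hsmul : ∀ c, ∀ t ∈ j, ∃ q, algebraMap (MvPolynomial (Fin m) K) F q =
      η (c * t) - algebraMap (MvPolynomial (Fin m) K) F c * η t) :
    ∃ y, ∀ t ∈ j, ∃ q, algebraMap (MvPolynomial (Fin m) K) F q =
      η t - algebraMap (MvPolynomial (Fin m) K) F t * y := by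
  by_cases hbot : j = ⊥
  · have := hj ⊥ Ideal.isPrime_bot hbot.le
    rw [td_congr (AlgEquiv.quotientBot K _), td_mvPolynomial] at this
    omega
  obtain ⟨u, huj, hu⟩ := Submodule.exists_mem_ne_zero_of_ne_bot hbot
  cases m with
  | zero =>
    have htop : j = ⊤ := by
      apply Ideal.eq_top_of_isUnit_mem _ huj
      rw [MvPolynomial.eq_C_of_isEmpty u] at hu ⊢
      exact (IsUnit.mk0 _ (fun h => hu (by rw [h]; simp))).map MvPolynomial.C
    refine ⟨η 1, fun t ht => ?_⟩
    simpa using hsmul t 1 (by simp [htop])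
  | succ m =>
    obtain ⟨e, he⟩ := exists_coord u hu
    obtain ⟨lc, hlc⟩ := he
    let _ : Algebra (Polynomial (MvPolynomial (Fin m) K)) F :=
      ((algebraMap (MvPolynomial (Fin (m+1)) K) F).comp e.symm.toRingEquiv.toRingHom).toAlgebra
    have halg : ∀ p, algebraMap (Polynomial (MvPolynomial (Fin m) K)) F p =
      algebraMap (MvPolynomial (Fin (m+1)) K) F (e.symm p) := fun p => rfl
    have : IsFractionRing (Polynomial (MvPolynomial (Fin m) K)) F := by
      have := IsLocalization.isLocalization_of_base_ringEquiv
        (nonZeroDivisors (MvPolynomial (Fin (m+1)) K)) F e.toRingEquiv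
      have h2 : (nonZeroDivisors (MvPolynomial (Fin (m+1)) K)).map (e.toRingEquiv : _ ≃* _) =
        nonZeroDivisors (Polynomial (MvPolynomial (Fin m) K)) := by
        exact MulEquivClass.map_nonZeroDivisors e.toRingEquiv
      unfold IsFractionRing
      rw [← h2]
      exact this
    let j' := j.comap e.symm
    let u' := Polynomial.C (↑lc⁻¹ : MvPolynomial (Fin m) K) * e u
    have hu'm : u'.Monic := by
      unfold Polynomial.Monic
      rw [Polynomial.leadingCoeff_C_mul_of_isUnit (Units.isUnit _), ← hlc]
      simp
    have hu'j : u' ∈ j' := by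
      refine Ideal.mul_mem_left _ _ ?_
      simpa [j'] using huj
    let c : MvPolynomial (Fin m) K →ₐ[K] Polynomial (MvPolynomial (Fin m) K) := Polynomial.CAlgHom
    have hint : ((Ideal.Quotient.mk j').comp c.toRingHom).IsIntegral := by
      exact hu'm.quotient_isIntegral hu'j
    have hp : ∀ p : Ideal (MvPolynomial (Fin m) K), p.IsPrime → j'.comap Polynomial.C ≤ p →
        td K (MvPolynomial (Fin m) K ⧸ p) + 3 ≤ m + 1 := by
      intro p hp hle
      obtain ⟨P, hP, hjP, hPp⟩ := lying_over_quot c.toRingHom j' hint p hle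
      have h1 := hj (P.comap e.toAlgHom) inferInstance (fun x hx => hjP (by simpa [j'] using hx))
      rw [td_quot_comap e.toAlgHom P (RingHom.isIntegral_of_surjective _ 
        (Ideal.Quotient.mk_surjective.comp e.surjective))] at h1
      have h2 : P.comap c = p := hPp
      rw [← td_quot_comap c P, h2] at h1
      · exact h1
      · exact isIntegral_mk_of_le _ hjP hint
    have hne : j'.comap Polynomial.C ≠ ⊥ := by
      intro h0
      have := hp ⊥ Ideal.isPrime_bot h0.le
      rw [td_congr (AlgEquiv.quotientBot K _), td_mvPolynomial] at this
      omega
    obtain ⟨v, hvj, hv⟩ := Submodule.exists_mem_ne_zero_of_ne_bot hne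
    obtain ⟨y, hy⟩ := L3core (F := F) u' hu'm hu'j (fun π hπ hle => by
      have h1 := hp _ ((Ideal.span_singleton_prime hπ.ne_zero).mpr hπ) hle
      have h2 := td_quotient_span_prime π hπ
      omega) v hv hvj (fun t => η (e.symm t)) (fun c t ht => by
        obtain ⟨q, hq⟩ := hsmul (e.symm c) (e.symm t) ht
        refine ⟨e q, ?_⟩
        simp only [halg, e.symm_apply_apply, hq, map_mul])
    refine ⟨y, fun t ht => ?_⟩
    obtain ⟨q, hq⟩ := hy (e t) (by simpa [j'] using ht)
    refine ⟨e.symm q, ?_⟩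
    simpa [halg] using hq

end P3
end GK

namespace GK
section P4

open nonZeroDivisors in
theorem L4 (Q B F L : Type*) [CommRing Q] [IsDomain Q] [IsNoetherianRing Q] [CommRing B] [IsDomain B]
    [IsIntegrallyClosed B] [Algebra Q B] [Module.Finite Q B] [FaithfulSMul Q B]
    [Field F] [Algebra Q F] [IsFractionRing Q F] [Field L] [Algebra B L] [IsFractionRing B L]
    [Algebra Q L] [IsScalarTower Q B L] [Algebra F L] [IsScalarTower Q F L] :
    ∃ (a : ℕ) (Λ : L →ₗ[F] (Fin a → F)), Function.Injective Λ ∧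
      (∀ b : B, ∀ i, ∃ q, algebraMap Q F q = Λ (algebraMap B L b) i) ∧
      ∀ z, (∀ i, ∃ q, algebraMap Q F q = Λ z i) → ∃ b, algebraMap B L b = z := by
  let f : B →ₗ[Q] L := (IsScalarTower.toAlgHom Q B L).toLinearMap
  let g : Q →ₗ[Q] F := Algebra.linearMap Q F
  have hf : ∀ b, f b = algebraMap B L b := fun b => rfl
  let E : (B →ₗ[Q] Q) →ₗ[Q] (L →ₗ[F] F) := IsLocalizedModule.mapExtendScalars Q⁰ f g F
  have hE : ∀ (l : B →ₗ[Q] Q) (b : B), E l (algebraMap B L b) = algebraMap Q F (l b) := by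
    intro l b
    rw [← hf]
    simp only [E, IsLocalizedModule.mapExtendScalars_apply_apply, IsLocalizedModule.map_apply]
    rfl
  have hext : ∀ l l' : L →ₗ[F] F, (∀ b, l (algebraMap B L b) = l' (algebraMap B L b)) → l = l' := by
    intro l l' h
    have : l.restrictScalars Q = l'.restrictScalars Q := by
      apply IsLocalizedModule.ext Q⁰ f (IsLocalizedModule.map_units g)
      ext b
      exact h b
    ext x
    exact DFunLike.congr_fun this x
  have hfinFL : Module.Finite F L := Module.Finite.of_isLocalizedModule Q⁰ f
  have hfp : Module.FinitePresentation Q B := Module.finitePresentation_of_finite Q B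
  have hsep : ∀ z : L, (∀ l, E l z = 0) → z = 0 := by
    intro z hz
    rw [← Module.forall_dual_apply_eq_zero_iff F]
    intro φ
    obtain ⟨l, s, hl⟩ := Module.FinitePresentation.exists_lift_of_isLocalizedModule Q⁰ g
      ((φ.restrictScalars Q) ∘ₗ f)
    have h1 : E l = (algebraMap Q F s) • φ := by
      apply hext
      intro b
      rw [hE]
      have := DFunLike.congr_fun hl b
      simp only [LinearMap.smul_apply, Algebra.smul_def, smul_eq_mul]
      rw [← hf]
      simpa [g, Submonoid.smul_def, Algebra.smul_def] using this
    have h2 := hz l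
    rw [h1] at h2
    simp only [LinearMap.smul_apply, smul_eq_mul] at h2
    refine (mul_eq_zero.mp h2).resolve_left ?_
    simpa using nonZeroDivisors.ne_zero s.2
  -- generators of dual
  obtain ⟨a, gens, hgens⟩ := Module.Finite.exists_fin (R := Q) (M := B →ₗ[Q] Q)
  let Λ : L →ₗ[F] (Fin a → F) := LinearMap.pi (fun i => E (gens i))
  have hall : ∀ z, (∀ i, ∃ q, algebraMap Q F q = Λ z i) → ∀ l, ∃ q, algebraMap Q F q = E l z := by
    intro z hz l
    have hl : l ∈ Submodule.span Q (Set.range gens) := by rw [hgens]; trivial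
    induction hl using Submodule.span_induction with
    | mem x h => obtain ⟨i, rfl⟩ := h; exact hz i
    | zero => exact ⟨0, by simp⟩
    | add x y _ _ hx hy =>
      obtain ⟨p, hp⟩ := hx; obtain ⟨q, hq⟩ := hy
      exact ⟨p + q, by simp [hp, hq]⟩
    | smul c x _ hx =>
      obtain ⟨p, hp⟩ := hx
      exact ⟨c * p, by simp [hp, Algebra.smul_def]⟩
  have hinj : Function.Injective Λ := by
    rw [injective_iff_map_eq_zero]
    intro z hz
    apply hsep
    intro l
    have hl : l ∈ Submodule.span Q (Set.range gens) := by rw [hgens]; trivial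
    induction hl using Submodule.span_induction with
    | mem x h => obtain ⟨i, rfl⟩ := h; exact congrFun hz i
    | zero => simp
    | add x y _ _ hx hy => simp [hx, hy]
    | smul c x _ hx => simp [hx]
  refine ⟨a, Λ, hinj, fun b i => ⟨gens i b, (hE _ _).symm⟩, fun z hz => ?_⟩
  -- the ring D
  have hmul : ∀ z w : L, (∀ l, ∃ q, algebraMap Q F q = E l z) → (∀ l, ∃ q, algebraMap Q F q = E l w) →
      ∀ l, ∃ q, algebraMap Q F q = E l (z * w) := by
    intro z w hz hw l
    -- first: b * z for b in B
    have hbz : ∀ b : B, ∃ q, algebraMap Q F q = E l (z * algebraMap B L b) := by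
      intro b
      obtain ⟨q, hq⟩ := hz (l ∘ₗ LinearMap.mulLeft Q b)
      refine ⟨q, ?_⟩
      rw [hq]
      have : E (l ∘ₗ LinearMap.mulLeft Q b) = E l ∘ₗ LinearMap.mulLeft F (algebraMap B L b) := by
        apply hext
        intro b'
        rw [hE]
        simp only [LinearMap.comp_apply, LinearMap.mulLeft_apply, ← map_mul, hE]
      rw [this]
      simp [mul_comm]
    choose c hc using hbz
    have hQinj : Function.Injective (algebraMap Q F) := IsFractionRing.injective Q F
    let lz : B →ₗ[Q] Q :=
      { toFun := c
        map_add' := fun x y => hQinj (by rw [map_add, hc, hc, hc, map_add, mul_add, map_add])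
        map_smul' := fun r x => hQinj (by
          have e : z * algebraMap B L (r • x) = algebraMap Q F r • (z * algebraMap B L x) := by
            rw [Algebra.smul_def, Algebra.smul_def, (algebraMap B L).map_mul,
              ← IsScalarTower.algebraMap_apply, ← IsScalarTower.algebraMap_apply]
            ring
          rw [hc, e, map_smul, ← hc]
          simp) }
    have h1 : E lz = E l ∘ₗ LinearMap.mulLeft F z := by
      apply hext
      intro b
      rw [hE]
      exact hc b
    obtain ⟨q, hq⟩ := hw lz
    exact ⟨q, by rw [hq, h1]; rfl⟩
  let D : Subalgebra Q L :=
    { carrier := {z | ∀ l, ∃ q, algebraMap Q F q = E l z}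
      mul_mem' := fun {z w} hz hw => hmul z w hz hw
      add_mem' := fun {z w} hz hw l => by
        obtain ⟨p, hp⟩ := hz l; obtain ⟨q, hq⟩ := hw l
        exact ⟨p + q, by simp [hp, hq]⟩
      algebraMap_mem' := fun r l => ⟨l (algebraMap Q B r), by
        rw [← hE, ← IsScalarTower.algebraMap_apply]⟩ }
  have hDfg : (Subalgebra.toSubmodule D).FG := by
    -- embed in Fin a → Q
    have hD : ∀ z : D, ∀ i, ∃ q, algebraMap Q F q = Λ z i := fun z i => z.2 (gens i)
    choose c hc using hD
    have hQinj : Function.Injective (algebraMap Q F) := IsFractionRing.injective Q F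
    let ψ : D →ₗ[Q] (Fin a → Q) :=
      { toFun := c
        map_add' := fun x y => by
          ext i; apply hQinj; simp only [Pi.add_apply, map_add, hc]; simp
        map_smul' := fun r x => by
          ext i; apply hQinj
          simp only [Pi.smul_apply, hc, RingHom.id_apply, smul_eq_mul, map_mul]
          have : ((r • x : D) : L) = algebraMap Q F r • (x : L) := by
            rw [Subalgebra.coe_smul, algebraMap_smul]
          rw [this, map_smul]; rfl }
    have hψ : Function.Injective ψ := by
      intro x y h
      apply Subtype.ext
      apply hinj
      ext i
      rw [← hc, ← hc]
      exact congrArg _ (congrFun h i)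
    have : IsNoetherian Q D := isNoetherian_of_injective ψ hψ
    exact (Module.Finite.iff_fg (N := Subalgebra.toSubmodule D)).mp
      (inferInstanceAs (Module.Finite Q D))
  have hzint : IsIntegral Q z := IsIntegral.of_mem_of_fg D hDfg z (hall z hz)
  exact IsIntegrallyClosed.algebraMap_eq_of_integral (R := B) (K := L) hzint.tower_top

end P4
end GK

namespace GK
section P5

/-- saturation `(c : I^∞)` -/
def sat {B : Type*} [CommRing B] (I : Ideal B) (c : B) : Ideal B where
  carrier := {b | ∃ N : ℕ, ∀ x ∈ I ^ N, c ∣ x * b}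
  zero_mem' := ⟨0, fun x _ => by simp⟩
  add_mem' := by
    rintro a b ⟨N, hN⟩ ⟨M, hM⟩
    refine ⟨max N M, fun x hx => ?_⟩
    rw [mul_add]
    exact dvd_add (hN x (Ideal.pow_le_pow_right (le_max_left _ _) hx))
      (hM x (Ideal.pow_le_pow_right (le_max_right _ _) hx))
  smul_mem' := by
    rintro a b ⟨N, hN⟩
    refine ⟨N, fun x hx => ?_⟩
    rw [smul_eq_mul, mul_left_comm]
    exact (hN x hx).mul_left a

lemma mem_sat {B : Type*} [CommRing B] {I : Ideal B} {c b : B} :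
    b ∈ sat I c ↔ ∃ N : ℕ, ∀ x ∈ I ^ N, c ∣ x * b := Iff.rfl

lemma self_mem_sat {B : Type*} [CommRing B] (I : Ideal B) (c : B) : c ∈ sat I c :=
  ⟨0, fun x _ => Dvd.intro_left x rfl⟩

lemma dvd_mem_sat {B : Type*} [CommRing B] (I : Ideal B) {c b : B} (h : c ∣ b) : b ∈ sat I c :=
  ⟨0, fun x _ => h.mul_left x⟩

lemma sat_mono {B : Type*} [CommRing B] (I : Ideal B) {c d : B} (h : c ∣ d) : sat I d ≤ sat I c :=
  fun _ ⟨N, hN⟩ => ⟨N, fun x hx => h.trans (hN x hx)⟩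

lemma sat_uniform {B : Type*} [CommRing B] [IsNoetherianRing B] (I : Ideal B) (c : B) :
    ∃ N : ℕ, ∀ b ∈ sat I c, ∀ x ∈ I ^ N, c ∣ x * b := by
  obtain ⟨s, hs⟩ := (inferInstance : IsNoetherian B B).noetherian (sat I c)
  have h1 : ∀ b : B, ∃ N : ℕ, b ∈ sat I c → ∀ x ∈ I ^ N, c ∣ x * b := by
    intro b
    by_cases hb : b ∈ sat I c
    · obtain ⟨N, hN⟩ := hb; exact ⟨N, fun _ => hN⟩
    · exact ⟨0, fun h => absurd h hb⟩
  choose N hN using h1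
  refine ⟨s.sup N, fun b hb => ?_⟩
  rw [← hs] at hb
  induction hb using Submodule.span_induction with
  | mem y hy =>
    intro x hx
    have hys : y ∈ sat I c := by rw [← hs]; exact Submodule.subset_span hy
    exact hN y hys x (Ideal.pow_le_pow_right (Finset.le_sup hy) hx)
  | zero => intro x _; simp
  | add y z _ _ hy hz => intro x hx; rw [mul_add]; exact dvd_add (hy x hx) (hz x hx)
  | smul a y _ hy => intro x hx; rw [smul_eq_mul, mul_left_comm]; exact (hy x hx).mul_left a

lemma exists_proj {Q F : Type*} [CommRing Q] [IsDomain Q] [Field F] [Algebra Q F] [IsFractionRing Q F]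
    {a : ℕ} (V : Submodule F (Fin a → F)) :
    ∃ (c : ℕ) (π : (Fin a → F) →ₗ[F] (Fin c → F)), LinearMap.ker π = V ∧
      ∀ q : Fin a → Q, ∃ r : Fin c → Q, ∀ i, algebraMap Q F (r i) = π (fun j => algebraMap Q F (q j)) i := by
  let bs := Module.finBasis F ((Fin a → F) ⧸ V)
  let c := Module.finrank F ((Fin a → F) ⧸ V)
  let π0 : (Fin a → F) →ₗ[F] (Fin c → F) := bs.equivFun.toLinearMap ∘ₗ V.mkQ
  obtain ⟨d, hd⟩ := IsLocalization.exist_integer_multiples_of_finite (nonZeroDivisors Q)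
    (fun p : Fin a × Fin c => π0 (Pi.single p.1 1) p.2)
  have hd0 : algebraMap Q F d ≠ 0 := by
    simpa using nonZeroDivisors.ne_zero d.2
  refine ⟨c, algebraMap Q F d • π0, ?_, ?_⟩
  · rw [LinearMap.ker_smul _ _ hd0]
    simp [π0, LinearMap.ker_comp]
  · choose g hg using hd
    intro q
    refine ⟨fun i => ∑ j, q j * g (j, i), fun i => ?_⟩
    have h1 : (fun j => algebraMap Q F (q j)) = ∑ j, algebraMap Q F (q j) • (Pi.single j 1 : Fin a → F) := by
      rw [pi_eq_sum_univ' (fun j => algebraMap Q F (q j))]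
    rw [h1, map_sum, map_sum, Finset.sum_apply]
    refine Finset.sum_congr rfl fun j _ => ?_
    rw [map_mul, hg, map_smul]
    simp [Algebra.smul_def, Submonoid.smul_def]

end P5
end GK

namespace GK
section P6

theorem ONE_abs (Q B F L : Type*) [CommRing Q] [IsDomain Q] [UniqueFactorizationMonoid Q]
    [IsNoetherianRing Q] [CommRing B] [IsDomain B]
    [IsIntegrallyClosed B] [Algebra Q B] [Module.Finite Q B] [FaithfulSMul Q B]
    [Field F] [Algebra Q F] [IsFractionRing Q F] [Field L] [Algebra B L] [IsFractionRing B L]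
    [Algebra Q L] [IsScalarTower Q B L] [Algebra F L] [IsScalarTower Q F L]
    (f : B) (hf : f ≠ 0) (I J : Ideal B) (hIJ : I * J ≤ (Ideal.span {f}).radical)
    (H : ∀ 𝔟 : Ideal B, (∀ P : Ideal B, P.IsPrime → 𝔟 ≤ P → I ≤ P ∧ J ≤ P ∧ f ∈ P) →
      Ht2 (𝔟.comap (algebraMap Q B)) ∧ ∀ η : Q → F,
        (∀ c, ∀ t ∈ 𝔟.comap (algebraMap Q B), ∃ q, algebraMap Q F q = η (c * t) - algebraMap Q F c * η t) →
        ∃ y, ∀ t ∈ 𝔟.comap (algebraMap Q B), ∃ q, algebraMap Q F q = η t - algebraMap Q F t * y)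
    (𝔪 : Ideal B) (hm : 𝔪 ≠ ⊤) (p1 p2 : Ideal B) [p1.IsPrime] [p2.IsPrime] (h1 : p1 ≤ 𝔪) (h2 : p2 ≤ 𝔪)
    (hf1 : f ∈ p1) (hf2 : f ∈ p2) (hI : ¬ I ≤ p1) (hJ : ¬ J ≤ p2) : False := by
  have : IsNoetherianRing B := IsNoetherianRing.of_finite Q B
  obtain ⟨a, Λ, hΛi, hΛB, hΛz⟩ := L4 Q B F L
  have hBL : Function.Injective (algebraMap B L) := IsFractionRing.injective B L
  have hQL : ∀ u : Q, algebraMap Q L u = algebraMap B L (algebraMap Q B u) := fun u =>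
    IsScalarTower.algebraMap_apply Q B L u
  have hQF : ∀ u : Q, algebraMap Q L u = algebraMap F L (algebraMap Q F u) := fun u =>
    IsScalarTower.algebraMap_apply Q F L u
  have hΛu : ∀ (u : Q) (z : L) (i), Λ (algebraMap Q L u * z) i = algebraMap Q F u * Λ z i := by
    intro u z i
    rw [hQF, ← Algebra.smul_def, map_smul]; rfl
  let Gd : Ideal B → Prop := fun 𝔟 => ∀ P : Ideal B, P.IsPrime → 𝔟 ≤ P → I ≤ P ∧ J ≤ P ∧ f ∈ P
  have F2L : ∀ 𝔟, Gd 𝔟 → ∀ z : L, (∀ u ∈ 𝔟.comap (algebraMap Q B),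
      ∃ b, algebraMap B L b = algebraMap Q L u * z) → ∃ b, algebraMap B L b = z := by
    intro 𝔟 h𝔟 z hz
    refine hΛz z fun i => L2F (H 𝔟 h𝔟).1 fun t ht => ?_
    obtain ⟨b, hb⟩ := hz t ht
    obtain ⟨q, hq⟩ := hΛB b i
    exact ⟨q, by rw [hq, hb, hΛu]⟩
  have F2' : ∀ 𝔟, Gd 𝔟 → ∀ d c : B, d ≠ 0 → (∀ u ∈ 𝔟.comap (algebraMap Q B),
      d ∣ algebraMap Q B u * c) → d ∣ c := by
    intro 𝔟 h𝔟 d c hd hu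
    have hd' : algebraMap B L d ≠ 0 := by simpa using hd
    obtain ⟨b, hb⟩ := F2L 𝔟 h𝔟 (algebraMap B L c / algebraMap B L d) (by
      intro u hu'
      obtain ⟨e, he⟩ := hu u hu'
      refine ⟨e, ?_⟩
      rw [hQL, mul_div_assoc', ← map_mul, he, map_mul]
      field_simp)
    refine ⟨b, hBL ?_⟩
    rw [map_mul, hb]; field_simp
  have hfn : ∀ n : ℕ, f ^ n ≠ 0 := fun n => pow_ne_zero n hf
  have hfL : ∀ n : ℕ, algebraMap B L (f ^ n) ≠ 0 := fun n => by simpa using fun h => absurd h hf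
  have F3 : ∀ (n : ℕ) (b : B), b ∈ sat I (f ^ n) → b ∈ sat J (f ^ n) → f ^ n ∣ b := by
    rintro n b ⟨N, hN⟩ ⟨M, hM⟩
    refine F2' (Ideal.span {f ^ n} ⊔ I ^ N ⊔ J ^ M) ?_ _ _ (hfn n) ?_
    · intro P hP hle
      rw [sup_le_iff, sup_le_iff, Ideal.span_singleton_le_iff_mem] at hle
      exact ⟨hP.le_of_pow_le hle.1.2, hP.le_of_pow_le hle.2, hP.mem_of_pow_mem _ hle.1.1⟩
    · intro u hu
      rw [Ideal.mem_comap] at hu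
      obtain ⟨v, hv, w, hw, hvw⟩ := Submodule.mem_sup.mp hu
      obtain ⟨v1, hv1, v2, hv2, hv12⟩ := Submodule.mem_sup.mp hv
      rw [← hvw, ← hv12, add_mul, add_mul]
      exact dvd_add (dvd_add ((Ideal.mem_span_singleton.mp hv1).mul_right _) (hN _ hv2)) (hM _ hw)
  obtain ⟨M, hM⟩ := Ideal.exists_pow_le_of_le_radical_of_fg hIJ (IsNoetherian.noetherian _)
  have hMn : ∀ n : ℕ, ∀ x ∈ I ^ (M * n), ∀ y ∈ J ^ (M * n), f ^ n ∣ x * y := by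
    intro n x hx y hy
    have : x * y ∈ (I * J) ^ (M * n) := by
      rw [mul_pow]; exact Ideal.mul_mem_mul hx hy
    rw [pow_mul] at this
    have := Ideal.pow_right_mono hM n this
    rwa [Ideal.span_singleton_pow, Ideal.mem_span_singleton] at this
  let 𝔞 : ℕ → Ideal B := fun n => sat I (f ^ n) ⊔ sat J (f ^ n)
  have h𝔞 : ∀ n, Gd (𝔞 n) := by
    intro n P hP hle
    have hle' := sup_le_iff.mp hle
    refine ⟨hP.le_of_pow_le (n := M * n) (le_trans ?_ hle'.2),
      hP.le_of_pow_le (n := M * n) (le_trans ?_ hle'.1), hP.mem_of_pow_mem n (hle'.1 (self_mem_sat _ _))⟩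
    · intro x hx
      exact ⟨M * n, fun y hy => by rw [mul_comm]; exact hMn n x hx y hy⟩
    · intro y hy
      exact ⟨M * n, fun x hx => hMn n x hx y hy⟩
  let Cond : ℕ → B → (Fin a → F) → Prop := fun n b y => ∀ u : Q, ∀ k ∈ sat I (f ^ n),
    algebraMap Q B u - k ∈ sat J (f ^ n) → ∀ i, ∃ q, algebraMap Q F q =
      Λ (algebraMap B L (b * k) / algebraMap B L (f ^ n)) i - algebraMap Q F u * y i
  have hdec : ∀ n, ∀ u ∈ (𝔞 n).comap (algebraMap Q B), ∃ k ∈ sat I (f ^ n), algebraMap Q B u - k ∈ sat J (f ^ n) := by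
    intro n u hu
    obtain ⟨k, hk, k', hk', h⟩ := Submodule.mem_sup.mp (Ideal.mem_comap.mp hu)
    exact ⟨k, hk, by rwa [← h, add_sub_cancel_left]⟩
  have hdec' : ∀ n u k, k ∈ sat I (f ^ n) → algebraMap Q B u - k ∈ sat J (f ^ n) → u ∈ (𝔞 n).comap (algebraMap Q B) := by
    intro n u k hk hk'
    rw [Ideal.mem_comap]
    have := Submodule.add_mem_sup hk hk'
    rwa [add_sub_cancel] at this
  have hwell : ∀ n b k i, k ∈ sat I (f ^ n) → k ∈ sat J (f ^ n) →
      ∃ q, algebraMap Q F q = Λ (algebraMap B L (b * k) / algebraMap B L (f ^ n)) i := by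
    intro n b k i hk hk'
    obtain ⟨e, rfl⟩ := F3 n k hk hk'
    obtain ⟨q, hq⟩ := hΛB (b * e) i
    refine ⟨q, ?_⟩
    rw [hq, mul_left_comm, map_mul _ (f ^ n), mul_div_cancel_left₀ _ (hfL n)]
  have hex : ∀ n b, ∃ y, Cond n b y := by
    intro n b
    have hk : ∀ u, ∃ k, u ∈ (𝔞 n).comap (algebraMap Q B) → k ∈ sat I (f ^ n) ∧ algebraMap Q B u - k ∈ sat J (f ^ n) := by
      intro u
      by_cases hu : u ∈ (𝔞 n).comap (algebraMap Q B)
      · obtain ⟨k, h⟩ := hdec n u hu; exact ⟨k, fun _ => h⟩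
      · exact ⟨0, fun h => absurd h hu⟩
    choose k hk using hk
    have : ∀ i, ∃ y, ∀ t ∈ (𝔞 n).comap (algebraMap Q B), ∃ q, algebraMap Q F q =
        Λ (algebraMap B L (b * k t) / algebraMap B L (f ^ n)) i - algebraMap Q F t * y := by
      intro i
      refine (H _ (h𝔞 n)).2 (fun t => Λ (algebraMap B L (b * k t) / algebraMap B L (f ^ n)) i) ?_
      intro c t ht
      obtain ⟨q, hq⟩ := hwell n b (k (c * t) - algebraMap Q B c * k t) i
        (sub_mem (hk _ (Ideal.mul_mem_left _ c ht)).1 (Ideal.mul_mem_left _ _ (hk t ht).1))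
        (by
          have e1 := (hk _ (Ideal.mul_mem_left _ c ht)).2
          have e2 := Ideal.mul_mem_left _ (algebraMap Q B c) (hk t ht).2
          have := sub_mem e2 e1
          rw [map_mul] at this
          convert this using 1; ring)
      refine ⟨q, ?_⟩
      have e3 : algebraMap B L (b * (k (c * t) - algebraMap Q B c * k t)) / algebraMap B L (f ^ n) =
          algebraMap B L (b * k (c * t)) / algebraMap B L (f ^ n) -
          algebraMap Q L c * (algebraMap B L (b * k t) / algebraMap B L (f ^ n)) := by
        rw [hQL]; simp only [map_mul, map_sub]; ring
      rw [hq, ← hΛu, ← Pi.sub_apply, ← map_sub, e3]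
    choose y hy using this
    refine ⟨y, fun u l hl hl' i => ?_⟩
    have hu := hdec' n u l hl hl'
    obtain ⟨q, hq⟩ := hy i u hu
    obtain ⟨q', hq'⟩ := hwell n b (l - k u) i (sub_mem hl (hk u hu).1) (by
      have := sub_mem (hk u hu).2 hl'
      convert this using 1; ring)
    refine ⟨q + q', ?_⟩
    rw [map_add, hq, hq', mul_sub, map_sub, sub_div, map_sub, Pi.sub_apply]; ring
  have hadd : ∀ n b b' y y', Cond n b y → Cond n b' y' → Cond n (b + b') (y + y') := by
    intro n b b' y y' h h' u k hk hk' i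
    obtain ⟨q, hq⟩ := h u k hk hk' i
    obtain ⟨q', hq'⟩ := h' u k hk hk' i
    refine ⟨q + q', ?_⟩
    rw [map_add, hq, hq', add_mul, map_add, add_div, map_add, Pi.add_apply, Pi.add_apply]; ring
  have hsm : ∀ n (c : Q) b y, Cond n b y → Cond n (algebraMap Q B c * b) (algebraMap Q F c • y) := by
    intro n c b y h u k hk hk' i
    obtain ⟨q, hq⟩ := h u k hk hk' i
    refine ⟨c * q, ?_⟩
    rw [map_mul, hq, mul_assoc, map_mul _ (algebraMap Q B c), ← hQL, mul_div_assoc, hΛu, Pi.smul_apply, smul_eq_mul]; ring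
  have hup : ∀ n b y, Cond n b y → Cond (n + 1) (f * b) y := by
    intro n b y h u k hk hk' i
    have hd : f ^ n ∣ f ^ (n + 1) := pow_dvd_pow f (Nat.le_succ n)
    obtain ⟨q, hq⟩ := h u k (sat_mono I hd hk) (sat_mono J hd hk') i
    refine ⟨q, ?_⟩
    rw [hq, pow_succ', mul_assoc, map_mul _ f, map_mul _ f, mul_div_mul_left _ _ (by simpa using hf)]
  obtain ⟨c, π, hπ, hπQ⟩ := exists_proj (Q := Q) (LinearMap.range Λ)
  have hint : ∀ n b y, Cond n b y → ∀ j, ∃ q, algebraMap Q F q = π y j := by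
    intro n b y h j
    refine L2F (H _ (h𝔞 n)).1 fun u hu => ?_
    obtain ⟨k, hk, hk'⟩ := hdec n u hu
    choose q hq using h u k hk hk'
    obtain ⟨r, hr⟩ := hπQ q
    refine ⟨- r j, ?_⟩
    have e : (fun i => algebraMap Q F (q i)) = Λ (algebraMap B L (b * k) / algebraMap B L (f ^ n)) - algebraMap Q F u • y := by
      ext i; rw [hq]; rfl
    have e2 : π (Λ (algebraMap B L (b * k) / algebraMap B L (f ^ n))) = 0 := by
      rw [← LinearMap.mem_ker, hπ]; exact LinearMap.mem_range_self _ _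
    rw [map_neg, hr, e, map_sub, e2, map_smul, zero_sub, Pi.neg_apply, neg_neg]; rfl
  let S : ℕ → Submodule Q (Fin c → Q) := fun n =>
    { carrier := {ψ | ∃ b y, Cond n b y ∧ ∀ j, algebraMap Q F (ψ j) = π y j}
      zero_mem' := ⟨0, 0, fun u k _ _ i => ⟨0, by simp⟩, by simp⟩
      add_mem' := by
        rintro ψ ψ' ⟨b, y, h, hy⟩ ⟨b', y', h', hy'⟩
        exact ⟨b + b', y + y', hadd n _ _ _ _ h h', fun j => by simp [hy, hy']⟩
      smul_mem' := by
        rintro q ψ ⟨b, y, h, hy⟩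
        exact ⟨_, _, hsm n q _ _ h, fun j => by rw [map_smul, Pi.smul_apply, Pi.smul_apply, ← hy, smul_eq_mul, smul_eq_mul, map_mul]⟩ }
  have hSmono : Monotone S := by
    refine monotone_nat_of_le_succ fun n => ?_
    rintro ψ ⟨b, y, h, hy⟩
    exact ⟨f * b, y, hup n _ _ h, hy⟩
  obtain ⟨N, hN⟩ := monotone_stabilizes_iff_noetherian.mpr (inferInstance : IsNoetherian Q (Fin c → Q)) ⟨S, hSmono⟩
  have hN1 : S N = S (N + 1) := hN (N + 1) (Nat.le_succ N)
  obtain ⟨y, hy⟩ := hex (N + 1) 1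
  choose ψ hψ using hint _ _ _ hy
  have hψS : ψ ∈ S N := by rw [hN1]; exact ⟨1, y, hy, hψ⟩
  obtain ⟨b', y', hb', hy'⟩ := hψS
  set n := N + 1 with hn
  have hC : Cond n (1 - f * b') (y - y') := by
    have := hadd n _ _ _ _ hy (hsm n (-1) _ _ (hup N _ _ hb'))
    convert this using 1
    · simp [sub_eq_add_neg]
    · simp [sub_eq_add_neg]
  set b := 1 - f * b' with hb
  have hker : y - y' ∈ LinearMap.range Λ := by
    rw [← hπ, LinearMap.mem_ker, map_sub]
    ext j
    rw [Pi.sub_apply, ← hψ, ← hy', sub_self]; rfl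
  obtain ⟨z, hz⟩ := hker
  have hBz : ∀ u : Q, ∀ k ∈ sat I (f ^ n), algebraMap Q B u - k ∈ sat J (f ^ n) →
      ∃ e, algebraMap B L e = algebraMap B L (b * k) / algebraMap B L (f ^ n) - algebraMap Q L u * z := by
    intro u k hk hk'
    refine hΛz _ fun i => ?_
    obtain ⟨q, hq⟩ := hC u k hk hk' i
    refine ⟨q, ?_⟩
    rw [hq, ← hz, map_sub, Pi.sub_apply, hΛu]
  obtain ⟨w, hw⟩ := F2L _ (h𝔞 n) (algebraMap B L (f ^ n) * z) (by
    intro u hu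
    obtain ⟨k, hk, hk'⟩ := hdec n u hu
    obtain ⟨e, he⟩ := hBz u k hk hk'
    refine ⟨b * k - f ^ n * e, ?_⟩
    rw [map_sub, map_mul _ (f ^ n), he, mul_sub, mul_div_cancel₀ _ (hfL n)]
    ring)
  have hdvd : ∀ u : Q, ∀ k ∈ sat I (f ^ n), algebraMap Q B u - k ∈ sat J (f ^ n) →
      f ^ n ∣ b * k - algebraMap Q B u * w := by
    intro u k hk hk'
    obtain ⟨e, he⟩ := hBz u k hk hk'
    refine ⟨e, hBL ?_⟩
    rw [map_mul, he, map_sub, map_mul _ (algebraMap Q B u), hw, hQL, mul_sub, mul_div_cancel₀ _ (hfL n)]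
    ring
  have hw1 : w ∈ sat I (f ^ n) := by
    obtain ⟨N1, hN1⟩ := sat_uniform I (f ^ n)
    refine ⟨N1, fun x hx => F2' _ (h𝔞 n) _ _ (hfn n) fun u hu => ?_⟩
    obtain ⟨k, hk, hk'⟩ := hdec n u hu
    have e1 := (hN1 k hk x hx).mul_left b
    have e2 := (hdvd u k hk hk').mul_left x
    have := dvd_sub e1 e2
    convert this using 1; ring
  have hw2 : b - w ∈ sat J (f ^ n) := by
    obtain ⟨N1, hN1⟩ := sat_uniform J (f ^ n)
    refine ⟨N1, fun x hx => F2' _ (h𝔞 n) _ _ (hfn n) fun u hu => ?_⟩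
    obtain ⟨k, hk, hk'⟩ := hdec n u hu
    have e1 := (hN1 _ hk' x hx).mul_left b
    have e2 := (hdvd u k hk hk').mul_left x
    have := dvd_add e1 e2
    convert this using 1; ring
  have hsatp : ∀ (I' p : Ideal B), p.IsPrime → f ∈ p → ¬ I' ≤ p → sat I' (f ^ n) ≤ p := by
    rintro I' p hp hfp hIp x ⟨N1, hN1⟩
    by_contra hxp
    refine hIp (hp.le_of_pow_le (n := N1) fun t ht => ?_)
    have : t * x ∈ p := Ideal.mem_of_dvd _ (hN1 t ht) (Ideal.pow_mem_of_mem _ hfp n (Nat.succ_pos N))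
    exact (hp.mem_or_mem this).resolve_right hxp
  have hbm : b ∈ 𝔪 := by
    have := add_mem (h1 (hsatp I p1 ‹_› hf1 hI hw1)) (h2 (hsatp J p2 ‹_› hf2 hJ hw2))
    rwa [add_sub_cancel] at this
  refine hm ((Ideal.eq_top_iff_one _).mpr ?_)
  have := add_mem hbm (Ideal.mul_mem_right b' _ (h1 hf1))
  rwa [hb, sub_add_cancel] at this

end P6
end GK

namespace GK
section P7

theorem ONE {K B : Type*} [Field K] [CommRing B] [IsDomain B] [IsIntegrallyClosed B] [Algebra K B]
    (hfg : Algebra.FiniteType K B)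
    (f : B) (hf : f ≠ 0) (I J : Ideal B) (hIJ : I * J ≤ (Ideal.span {f}).radical)
    (hdim : ∀ P : Ideal B, P.IsPrime → I ≤ P → J ≤ P → f ∈ P → td K (B ⧸ P) + 3 ≤ td K B)
    (𝔪 : Ideal B) (hm : 𝔪 ≠ ⊤) (p1 p2 : Ideal B) [p1.IsPrime] [p2.IsPrime] (h1 : p1 ≤ 𝔪) (h2 : p2 ≤ 𝔪)
    (hf1 : f ∈ p1) (hf2 : f ∈ p2) (hI : ¬ I ≤ p1) (hJ : ¬ J ≤ p2) : False := by
  obtain ⟨m, g, hg, hgf⟩ := exists_finite_inj_algHom_of_fg K B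
  have hgint : g.toRingHom.IsIntegral := RingHom.Finite.to_isIntegral hgf
  have htd : td K B = m := by
    rw [← td_mvPolynomial K m]
    exact (td_eq_of_isIntegral g hg hgint).symm
  algebraize [g.toRingHom]
  have : Module.Finite (MvPolynomial (Fin m) K) B := hgf
  have : FaithfulSMul (MvPolynomial (Fin m) K) B := (faithfulSMul_iff_algebraMap_injective _ _).mpr hg
  let F := FractionRing (MvPolynomial (Fin m) K)
  let L := FractionRing B
  have : FaithfulSMul (MvPolynomial (Fin m) K) L := by
    rw [faithfulSMul_iff_algebraMap_injective, IsScalarTower.algebraMap_eq (MvPolynomial (Fin m) K) B L]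
    exact (IsFractionRing.injective B L).comp hg
  let _ : Algebra F L := FractionRing.liftAlgebra _ _
  have : IsScalarTower (MvPolynomial (Fin m) K) F L := FractionRing.isScalarTower_liftAlgebra _ _
  refine ONE_abs (MvPolynomial (Fin m) K) B F L f hf I J hIJ ?_ 𝔪 hm p1 p2 h1 h2 hf1 hf2 hI hJ
  intro 𝔟 h𝔟
  have hint : ∀ P : Ideal B, ((Ideal.Quotient.mk P).comp g.toRingHom).IsIntegral := fun P =>
    isIntegral_mk_of_le (j := ⊥) g.toRingHom bot_le (RingHom.IsIntegral.trans _ _ hgint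
      (RingHom.isIntegral_of_surjective _ Ideal.Quotient.mk_surjective))
  have key : ∀ P : Ideal (MvPolynomial (Fin m) K), P.IsPrime → 𝔟.comap (algebraMap (MvPolynomial (Fin m) K) B) ≤ P →
      td K (MvPolynomial (Fin m) K ⧸ P) + 3 ≤ m := by
    intro P hP hle
    obtain ⟨P', hP', hle', hc⟩ := lying_over_quot g.toRingHom 𝔟 (hint _) P hle
    have e := td_quot_comap g P' (hint P')
    have e2 : P'.comap g = P := hc
    rw [e2] at e
    rw [e, ← htd]
    obtain ⟨a, b, c⟩ := h𝔟 P' hP' hle'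
    exact hdim P' hP' a b c
  refine ⟨fun π hπ hle => ?_, fun η hη => L3 key η hη⟩
  have h1 := key _ ((Ideal.span_singleton_prime hπ.ne_zero).mpr hπ) hle
  have h2 := td_quotient_span_prime π hπ
  omega

end P7
end GK

namespace GK
section P8

structure Good (K A : Type*) [Field K] [CommRing A] [Algebra K A] (m : ℕ) : Prop where
  dom : IsDomain A
  ex : ∃ g : MvPolynomial (Fin m) K →ₐ[K] A, Function.Injective g ∧ g.toRingHom.IsIntegral
  aic : ∀ p : Polynomial A, p.Monic → p.natDegree ≠ 0 → ∃ x, p.IsRoot x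

lemma Good.td_eq {K A : Type*} [Field K] [CommRing A] [Algebra K A] {m : ℕ} (h : Good K A m) : td K A = m := by
  obtain ⟨g, hg, hi⟩ := h.ex
  have := h.dom
  rw [← td_eq_of_isIntegral g hg hi, td_mvPolynomial]

lemma isIntegral_mk_comp {D E : Type*} [CommRing D] [CommRing E]
    (g : D →+* E) (hg : g.IsIntegral) (P : Ideal E) : ((Ideal.Quotient.mk P).comp g).IsIntegral :=
  isIntegral_mk_of_le (j := ⊥) g bot_le (RingHom.IsIntegral.trans _ _ hg
      (RingHom.isIntegral_of_surjective _ Ideal.Quotient.mk_surjective))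

lemma aic_quot {A : Type*} [CommRing A]
    (aic : ∀ p : Polynomial A, p.Monic → p.natDegree ≠ 0 → ∃ x, p.IsRoot x) (P : Ideal A) :
    ∀ p : Polynomial (A ⧸ P), p.Monic → p.natDegree ≠ 0 → ∃ x, p.IsRoot x := by
  intro p hp hd
  obtain ⟨q, hq, hqd, hqm⟩ := Polynomial.lifts_and_natDegree_eq_and_monic (f := Ideal.Quotient.mk P) (p := p)
    ((Polynomial.mem_lifts _).mpr (Polynomial.map_surjective _ Ideal.Quotient.mk_surjective p)) hp
  obtain ⟨x, hx⟩ := aic q hqm (by rwa [hqd])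
  refine ⟨Ideal.Quotient.mk P x, ?_⟩
  rw [← hq]; exact hx.map

lemma Good.quot {K A : Type*} [Field K] [CommRing A] [Algebra K A] {m : ℕ} (h : Good K A m) (P : Ideal A)
    [hP : P.IsPrime] : Good K (A ⧸ P) (td K (A ⧸ P)) := by
  obtain ⟨g, hg, hi⟩ := h.ex
  have hd : IsDomain (A ⧸ P) := inferInstance
  have : (P.comap g).IsPrime := Ideal.comap_isPrime g P
  obtain ⟨s, -, g', hg', hi'⟩ := exists_integral_inj_algHom_of_quotient (P.comap g) this.ne_top
  let f : (MvPolynomial (Fin m) K ⧸ P.comap g) →ₐ[K] A ⧸ P := Ideal.quotientMapₐ P g le_rfl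
  have hf : Function.Injective f := Ideal.quotientMap_injective' (H := le_rfl) le_rfl
  have hfi : f.toRingHom.IsIntegral := by
    refine RingHom.IsIntegral.tower_top (Ideal.Quotient.mk _) _ ?_
    exact isIntegral_mk_comp g.toRingHom hi P
  have hinj : Function.Injective (f.comp g') := hf.comp hg'
  have hint : (f.comp g').toRingHom.IsIntegral := RingHom.IsIntegral.trans _ _ hi' hfi
  have : td K (A ⧸ P) = s := by
    rw [← td_mvPolynomial K s]; exact (td_eq_of_isIntegral _ hinj hint).symm
  rw [this]
  exact ⟨hd, ⟨_, hinj, hint⟩, aic_quot h.aic P⟩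

lemma aic_intClosed {A : Type*} [CommRing A] [IsDomain A]
    (aic : ∀ p : Polynomial A, p.Monic → p.natDegree ≠ 0 → ∃ x, p.IsRoot x) : IsIntegrallyClosed A := by
  have key : ∀ d : ℕ, ∀ p : Polynomial A, p.Monic → p.natDegree = d → ∀ x : FractionRing A,
      Polynomial.aeval x p = 0 → ∃ a, algebraMap A (FractionRing A) a = x := by
    intro d
    induction d with
    | zero =>
      intro p hp hd x hx
      rw [Polynomial.eq_one_of_monic_natDegree_zero hp hd] at hx
      simp at hx
    | succ d ih =>
      intro p hp hd x hx
      obtain ⟨a, ha⟩ := aic p hp (by omega)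
      obtain ⟨q, rfl⟩ := Polynomial.dvd_iff_isRoot.mpr ha
      have hqm : q.Monic := (Polynomial.monic_X_sub_C a).of_mul_monic_left hp
      rw [(Polynomial.monic_X_sub_C a).natDegree_mul hqm, Polynomial.natDegree_X_sub_C] at hd
      rw [map_mul, mul_eq_zero] at hx
      rcases hx with hx | hx
      · refine ⟨a, ?_⟩
        simp only [map_sub, Polynomial.aeval_X, Polynomial.aeval_C, sub_eq_zero] at hx
        exact hx.symm
      · exact ih q hqm (by omega) x hx
  rw [isIntegrallyClosed_iff (FractionRing A)]
  rintro x ⟨p, hp, hx⟩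
  exact key _ p hp rfl x hx

lemma comap_ne_bot_int {D E : Type*} [CommRing D] [IsDomain D] [CommRing E] [IsDomain E] (g : D →+* E) (hi : g.IsIntegral)
    (P : Ideal E) (hP : P ≠ ⊥) : P.comap g ≠ ⊥ := by
  algebraize [g]
  obtain ⟨x, hx, hx0⟩ := Submodule.exists_mem_ne_zero_of_ne_bot hP
  exact Ideal.comap_ne_bot_of_integral_mem hx0 hx (hi x)

lemma td_quot_lt' {K A : Type*} [Field K] [CommRing A] [IsDomain A] [Algebra K A] {m : ℕ}
    (g : MvPolynomial (Fin m) K →ₐ[K] A) (hi : g.toRingHom.IsIntegral)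
    (P : Ideal A) [P.IsPrime] (hP : P ≠ ⊥) : td K (A ⧸ P) < m := by
  rw [← td_quot_comap g P (isIntegral_mk_comp g.toRingHom hi P)]
  have : (P.comap g).IsPrime := Ideal.comap_isPrime g P
  exact td_quotient_lt _ (comap_ne_bot_int g.toRingHom hi P hP)

/-- finite level -/
theorem FL.{v} {K : Type*} {A : Type v} [Field K] [CommRing A] [Algebra K A] {m : ℕ} (h : Good K A m)
    (s : Finset A) : ∃ (N : ℕ) (B : Type v) (_ : CommRing B) (_ : Algebra K B)
    (j : MvPolynomial (Fin m) K →ₐ[K] B) (ι : B →ₐ[K] A), N ≠ 0 ∧ IsDomain B ∧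
      IsIntegrallyClosed B ∧ Algebra.FiniteType K B ∧ Function.Injective j ∧ j.toRingHom.IsIntegral ∧
      Function.Injective ι ∧ ι.toRingHom.IsIntegral ∧
      ∀ a ∈ s, ∃ b, ι b = a ^ N := by
  obtain ⟨g, hg, hi⟩ := h.ex
  have hA := h.dom
  have hIC := aic_intClosed h.aic
  let Q := MvPolynomial (Fin m) K
  algebraize [g.toRingHom]
  have hfsA : FaithfulSMul Q A := (faithfulSMul_iff_algebraMap_injective _ _).mpr hg
  have hAi : Algebra.IsIntegral Q A := ⟨hi⟩
  let F := FractionRing Q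
  let L := FractionRing A
  have : FaithfulSMul Q L := by
    rw [faithfulSMul_iff_algebraMap_injective, IsScalarTower.algebraMap_eq Q A L]
    exact (IsFractionRing.injective A L).comp hg
  let _ : Algebra F L := FractionRing.liftAlgebra _ _
  have : IsScalarTower Q F L := FractionRing.isScalarTower_liftAlgebra _ _
  have hIA : IsIntegralClosure A Q L := ⟨IsFractionRing.injective A L, by
    intro x
    constructor
    · intro hx
      exact IsIntegrallyClosed.isIntegral_iff.mp (hx.tower_top (A := A))
    · rintro ⟨y, rfl⟩
      exact IsIntegral.map (IsScalarTower.toAlgHom Q A L) (hAi.isIntegral y)⟩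
  have halgA : Algebra.IsAlgebraic Q L := (IsFractionRing.isAlgebraic_iff' Q A L).mp inferInstance
  have halg : Algebra.IsAlgebraic F L := (IsFractionRing.comap_isAlgebraic_iff (A := Q)).mp halgA
  let Ls := separableClosure F L
  let q := ringExpChar F
  have : ExpChar Ls q := expChar_of_injective_algebraMap (algebraMap F Ls).injective q
  have hp : ∀ x : L, ∃ n : ℕ, x ^ q ^ n ∈ Ls := by
    intro x
    obtain ⟨n, y, hy⟩ := IsPurelyInseparable.pow_mem Ls q x
    exact ⟨n, hy ▸ y.2⟩
  choose e he using hp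
  let n := s.sup fun a => e (algebraMap A L a)
  have hn : ∀ a ∈ s, algebraMap A L (a ^ q ^ n) ∈ Ls := by
    intro a ha
    have hle : e (algebraMap A L a) ≤ n := Finset.le_sup (f := fun a => e (algebraMap A L a)) ha
    rw [map_pow, ← Nat.add_sub_cancel' hle, pow_add, pow_mul]
    exact pow_mem (he _) _
  let T : Set L := (fun a => algebraMap A L (a ^ q ^ n)) '' (s : Set A)
  let E : IntermediateField F L := IntermediateField.adjoin F T
  have hEL : E ≤ Ls := by
    rw [IntermediateField.adjoin_le_iff]
    rintro _ ⟨a, ha, rfl⟩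
    exact hn a ha
  have hsep : Algebra.IsSeparable F E := le_separableClosure_iff F L E |>.mp hEL
  have : Finite T := Set.Finite.to_subtype ((s.finite_toSet).image _)
  have hfd : FiniteDimensional F E := IntermediateField.finiteDimensional_adjoin fun x _ => (halg.isAlgebraic x).isIntegral
  have : IsScalarTower Q E L := IsScalarTower.of_algebraMap_eq fun x => rfl
  let C := integralClosure Q E
  let _ : Algebra K C := ((algebraMap Q C).comp (algebraMap K Q)).toAlgebra
  have : IsScalarTower K Q C := IsScalarTower.of_algebraMap_eq fun x => rfl
  have hCf : Module.Finite Q C := IsIntegralClosure.finite Q F E C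
  have hCi : Algebra.IsIntegral Q C := inferInstance
  have hCc : IsIntegrallyClosed C := integralClosure.isIntegrallyClosedOfFiniteExtension F
  have hQCL : @IsScalarTower Q C L Algebra.toSMul Algebra.toSMul Algebra.toSMul :=
    IsScalarTower.of_algebraMap_eq fun x => by
      rw [IsScalarTower.algebraMap_apply Q E L]; rfl
  have : IsScalarTower K Q A := IsScalarTower.of_algebraMap_eq fun x => (g.commutes x).symm
  let ι := IsIntegralClosure.lift Q A L (S := C)
  have hι : ∀ x : C, algebraMap A L (ι x) = algebraMap C L x := fun x =>
    IsIntegralClosure.algebraMap_lift Q A L x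
  have hCinj : Function.Injective (algebraMap C L) :=
    (algebraMap E L).injective.comp Subtype.val_injective
  have hK : ∀ x : K, ι.toRingHom (algebraMap K C x) = algebraMap K A x := fun x =>
    (ι.commutes (algebraMap K Q x)).trans (g.commutes x)
  refine ⟨q ^ n, C, inferInstance, inferInstance, IsScalarTower.toAlgHom K Q C, ⟨ι.toRingHom, hK⟩,
    pow_ne_zero _ (expChar_ne_zero F q), inferInstance, hCc, ?_, ?_, ?_, ?_, ?_, ?_⟩
  · exact Algebra.FiniteType.trans (S := Q) inferInstance inferInstance
  · intro x y hxy
    have h2 : ι (algebraMap Q C x) = ι (algebraMap Q C y) := congrArg ι hxy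
    rw [ι.commutes, ι.commutes] at h2
    exact hg h2
  · exact hCi.isIntegral
  · intro x y hxy
    refine hCinj ?_
    rw [← hι, ← hι]; exact congrArg _ hxy
  · refine RingHom.IsIntegral.tower_top (algebraMap Q C) ι.toRingHom ?_
    have : ι.toRingHom.comp (algebraMap Q C) = algebraMap Q A := ι.comp_algebraMap
    rw [this]; exact hi
  · intro a ha
    have hT : algebraMap A L (a ^ q ^ n) ∈ E := IntermediateField.subset_adjoin F T ⟨a, ha, rfl⟩
    refine ⟨⟨⟨_, hT⟩, ?_⟩, ?_⟩
    · have h3 : IsIntegral Q (algebraMap A L (a ^ q ^ n)) :=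
        IsIntegral.map (IsScalarTower.toAlgHom Q A L) (hAi.isIntegral _)
      have h4 : IsIntegral Q (algebraMap E L ⟨_, hT⟩) := h3
      exact (isIntegral_algebraMap_iff (algebraMap E L).injective).mp h4
    · refine IsFractionRing.injective A L ?_
      exact hι _

end P8
end GK

namespace GK
section P9

lemma going_down_int {D E : Type*} [CommRing D] [IsDomain D] [IsIntegrallyClosed D] [CommRing E] [IsDomain E]
    (g : D →+* E) (hg : Function.Injective g) (hi : g.IsIntegral) (p : Ideal D) [p.IsPrime] (P : Ideal E)
    [P.IsPrime] (hle : p ≤ P.comap g) : ∃ P' ≤ P, P'.IsPrime ∧ P'.comap g = p := by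
  algebraize [g]
  have : FaithfulSMul D E := (faithfulSMul_iff_algebraMap_injective _ _).mpr hg
  have : (P.comap g).IsPrime := Ideal.comap_isPrime g P
  have : P.LiesOver (P.comap g) := ⟨rfl⟩
  obtain ⟨P', h1, h2, h3⟩ := Ideal.exists_ideal_le_liesOver_of_le (p := p) (q := P.comap g) P hle
  exact ⟨P', h1, h2, h3.over.symm⟩

lemma eq_of_height_le_one {B : Type*} [CommRing B] [IsDomain B] {p p1 : Ideal B} [p.IsPrime] [p1.IsPrime]
    (h : p.height ≤ 1) (h1 : p1 ≤ p) (h0 : p1 ≠ ⊥) : p1 = p := by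
  by_contra hne
  have e1 := Ideal.height_le_iff (n := 1) |>.mp (by exact_mod_cast h) p1 inferInstance (lt_of_le_of_ne h1 hne)
  have e2 := Ideal.height_le_iff (p := p1) (n := 0) |>.mp (by
    exact_mod_cast Order.le_of_lt_succ (by simpa using e1)) ⊥ Ideal.isPrime_bot (bot_lt_iff_ne_bot.mpr h0)
  simp at e2

lemma D1 {K A : Type*} [Field K] [CommRing A] [Algebra K A] {m : ℕ} (h : Good K A m)
    (f : A) (P : Ideal A) (hP : P ∈ (Ideal.span {f}).minimalPrimes) : m ≤ td K (A ⧸ P) + 1 := by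
  have hA := h.dom
  have hPp : P.IsPrime := hP.1.1
  obtain ⟨N, B, _, _, j, ι, hN, hBd, hBi, hBf, hj, hji, hι, hιi, hs⟩ := FL h {f}
  obtain ⟨b, hb⟩ := hs f (by simp)
  have hfP : f ∈ P := hP.1.2 (Ideal.mem_span_singleton_self f)
  have hpp : (P.comap ι).IsPrime := Ideal.comap_isPrime ι P
  have : IsNoetherianRing B := Algebra.FiniteType.isNoetherianRing K B
  have hmin : P.comap ι ∈ (Ideal.span {b}).minimalPrimes := by
    refine ⟨⟨hpp, ?_⟩, ?_⟩
    · rw [Ideal.span_singleton_le_iff_mem, Ideal.mem_comap, hb]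
      exact Ideal.pow_mem_of_mem _ hfP N (Nat.pos_of_ne_zero hN)
    · rintro p' ⟨hp', hbp'⟩ hle
      obtain ⟨P', hP'P, hP'p, hc⟩ := going_down_int ι.toRingHom hι hιi p' P hle
      have hc' : P'.comap ι = p' := hc
      have hfP' : f ∈ P' := by
        refine hP'p.mem_of_pow_mem N ?_
        rw [← hb, ← Ideal.mem_comap, hc']
        exact hbp' (Ideal.mem_span_singleton_self b)
      rw [← hc']
      exact Ideal.comap_mono (hP.2 ⟨hP'p, (Ideal.span_singleton_le_iff_mem _).mpr hfP'⟩ hP'P)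
  have hht := Ideal.height_le_one_of_isPrincipal_of_mem_minimalPrimes _ _ hmin
  rw [← td_quot_comap ι P (isIntegral_mk_comp ι.toRingHom hιi P)]
  rw [← td_quot_comap j (P.comap ι) (isIntegral_mk_comp j.toRingHom hji _)]
  have hqp : ((P.comap ι).comap j).IsPrime := Ideal.comap_isPrime j _
  by_cases hq : (P.comap ι).comap j = ⊥
  · rw [hq, td_congr (AlgEquiv.quotientBot K _), td_mvPolynomial]; omega
  · obtain ⟨π, hπq, hπ⟩ := hqp.exists_mem_prime_of_ne_bot hq
    have hsp : (Ideal.span {π}).IsPrime := (Ideal.span_singleton_prime hπ.ne_zero).mpr hπ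
    obtain ⟨p1, hp1, hp1p, hc⟩ := going_down_int j.toRingHom hj hji (Ideal.span {π}) (P.comap ι)
      ((Ideal.span_singleton_le_iff_mem _).mpr hπq)
    have hne : p1 ≠ ⊥ := by
      rintro rfl
      have : j.toRingHom π ∈ (⊥ : Ideal B) := by
        rw [← Ideal.mem_comap, hc]; exact Ideal.mem_span_singleton_self π
      have h0 : j π = 0 := this
      exact hπ.ne_zero ((map_eq_zero_iff j hj).mp h0)
    have e := eq_of_height_le_one hht hp1 hne
    have hc' : (P.comap ι).comap j = Ideal.span {π} := by rw [← e]; exact hc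
    rw [hc', td_quotient_span_prime π hπ]

lemma td_loc {K D E : Type*} [Field K] [CommRing D] [IsDomain D] [CommRing E] [IsDomain E] [Algebra K D] [Algebra K E]
    (g : D →ₐ[K] E) (hg : Function.Injective g) (h : ∀ x : E, ∃ d ≠ 0, ∃ d', g d * x = g d') :
    td K D = td K E := by
  algebraize [g.toRingHom]
  have : FaithfulSMul D E := (faithfulSMul_iff_algebraMap_injective D E).mpr hg
  have : Algebra.IsAlgebraic D E := ⟨fun x => by
    obtain ⟨d, hd, d', hd'⟩ := h x
    refine ⟨Polynomial.C d * Polynomial.X - Polynomial.C d', ?_, ?_⟩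
    · intro h0
      have := congrArg (fun p => Polynomial.coeff p 1) h0
      simp [Polynomial.coeff_C] at this
      exact hd this
    · simp only [map_sub, map_mul, Polynomial.aeval_C, Polynomial.aeval_X]
      exact sub_eq_zero.mpr hd'⟩
  exact td_eq_of_algebraic K

lemma exists_away {B : Type*} [CommRing B] [IsNoetherianRing B] (𝔪 : Ideal B) [𝔪.IsPrime] (𝔠 : Ideal B) :
    ∃ h ∉ 𝔪, ∀ p : Ideal B, p.IsPrime → 𝔠 ≤ p → h ∉ p → ∃ p0 : Ideal B, p0.IsPrime ∧ 𝔠 ≤ p0 ∧ p0 ≤ p ∧ p0 ≤ 𝔪 := by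
  have hfin := Ideal.finite_minimalPrimes_of_isNoetherianRing B 𝔠
  have : ∀ q : Ideal B, ∃ x : B, x ∉ 𝔪 ∧ (q ≤ 𝔪 ∨ x ∈ q) := by
    intro q
    by_cases hq : q ≤ 𝔪
    · exact ⟨1, (Ideal.ne_top_iff_one _).mp (Ideal.IsPrime.ne_top ‹_›), Or.inl hq⟩
    · obtain ⟨x, hx, hx'⟩ := SetLike.not_le_iff_exists.mp hq
      exact ⟨x, hx', Or.inr hx⟩
  choose x hx hx' using this
  refine ⟨∏ q ∈ hfin.toFinset, x q, ?_, ?_⟩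
  · intro hmem
    obtain ⟨q, -, hq⟩ := (Ideal.IsPrime.prod_mem_iff (p := 𝔪)).mp hmem
    exact hx q hq
  · intro p hp hcp hhp
    obtain ⟨p0, hp0, hle⟩ := Ideal.exists_minimalPrimes_le hcp
    refine ⟨p0, hp0.1.1, hp0.1.2, hle, (hx' p0).resolve_right fun hmem => hhp ?_⟩
    exact hle (Ideal.mem_of_dvd _ (Finset.dvd_prod_of_mem x (hfin.mem_toFinset.mpr hp0)) hmem)

end P9
end GK

namespace GK
section P10

theorem ONE_loc {K B : Type*} [Field K] [CommRing B] [IsDomain B] [IsIntegrallyClosed B] [Algebra K B]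
    (hfg : Algebra.FiniteType K B)
    (f : B) (hf : f ≠ 0) (I J : Ideal B) (𝔪 : Ideal B) [h𝔪 : 𝔪.IsPrime]
    (hIJ : ∀ P : Ideal B, P.IsPrime → P ≤ 𝔪 → f ∈ P → I ≤ P ∨ J ≤ P)
    (hdim : ∀ P : Ideal B, P.IsPrime → P ≤ 𝔪 → I ≤ P → J ≤ P → f ∈ P → td K (B ⧸ P) + 3 ≤ td K B)
    (p1 p2 : Ideal B) [hp1 : p1.IsPrime] [hp2 : p2.IsPrime] (h1 : p1 ≤ 𝔪) (h2 : p2 ≤ 𝔪)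
    (hf1 : f ∈ p1) (hf2 : f ∈ p2) (hI : ¬ I ≤ p1) (hJ : ¬ J ≤ p2) : False := by
  have : IsNoetherianRing B := Algebra.FiniteType.isNoetherianRing K B
  obtain ⟨a, ha, ha'⟩ := exists_away 𝔪 (Ideal.span {f})
  obtain ⟨b, hb, hb'⟩ := exists_away 𝔪 (Ideal.span {f} ⊔ I ⊔ J)
  set h := a * b with hh
  have hhm : h ∉ 𝔪 := fun hm => (h𝔪.mem_or_mem hm).elim ha hb
  have hh0 : h ≠ 0 := fun h0 => hhm (h0 ▸ 𝔪.zero_mem)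
  let M := Submonoid.powers h
  have hM : M ≤ nonZeroDivisors B := powers_le_nonZeroDivisors_of_noZeroDivisors hh0
  let C := Localization M
  have : IsDomain C := IsLocalization.isDomain_localization hM
  have : IsIntegrallyClosed C := isIntegrallyClosed_of_isLocalization C M hM
  have hCf : Algebra.FiniteType K C := inferInstance
  have hinj : Function.Injective (algebraMap B C) := IsLocalization.injective C hM
  let g : B →ₐ[K] C := IsScalarTower.toAlgHom K B C
  have hfrac : ∀ x : C, ∃ n : ℕ, ∃ d', algebraMap B C (h ^ n) * x = algebraMap B C d' := by
    intro x
    obtain ⟨⟨d', ⟨_, n, rfl⟩⟩, hx⟩ := IsLocalization.surj M x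
    exact ⟨n, d', by rw [mul_comm]; exact hx⟩
  have htdC : td K B = td K C := td_loc g hinj fun x => by
    obtain ⟨n, d', hd⟩ := hfrac x
    exact ⟨h ^ n, pow_ne_zero _ hh0, d', hd⟩
  have hdisj : ∀ p : Ideal B, p ≤ 𝔪 → Disjoint (M : Set B) p := by
    intro p hp
    rw [Set.disjoint_left]
    rintro _ ⟨n, rfl⟩ hx
    exact hhm (h𝔪.mem_of_pow_mem n (hp hx))
  have hcomap : ∀ p : Ideal B, p.IsPrime → p ≤ 𝔪 → (p.map (algebraMap B C)).comap (algebraMap B C) = p :=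
    fun p hp hle => IsLocalization.under_map_of_isPrime_disjoint M C hp (hdisj p hle)
  have hprime : ∀ p : Ideal B, p.IsPrime → p ≤ 𝔪 → (p.map (algebraMap B C)).IsPrime :=
    fun p hp hle => IsLocalization.isPrime_of_isPrime_disjoint M C p hp (hdisj p hle)
  have hunit : ∀ P : Ideal C, P.IsPrime → h ∉ P.comap (algebraMap B C) := by
    intro P hP hmem
    exact hP.ne_top (Ideal.eq_top_of_isUnit_mem _ hmem (IsLocalization.map_units C (⟨h, Submonoid.mem_powers h⟩ : M)))
  have hle : ∀ (X : Ideal B) (P : Ideal C), X.map (algebraMap B C) ≤ P ↔ X ≤ P.comap (algebraMap B C) := fun X P =>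
    Ideal.map_le_iff_le_comap
  have hp1' := hprime p1 hp1 h1
  have hp2' := hprime p2 hp2 h2
  have hm' := hprime 𝔪 h𝔪 le_rfl
  refine ONE (K := K) hCf (algebraMap B C f) (by simpa using fun h0 => hf (hinj (by simpa using h0)))
    (I.map (algebraMap B C)) (J.map (algebraMap B C)) ?_ ?_
    (𝔪.map (algebraMap B C)) hm'.ne_top (p1.map (algebraMap B C)) (p2.map (algebraMap B C))
    (Ideal.map_mono h1) (Ideal.map_mono h2) (Ideal.mem_map_of_mem _ hf1) (Ideal.mem_map_of_mem _ hf2) ?_ ?_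
  · rw [Ideal.radical_eq_sInf]
    refine le_sInf fun P hP => ?_
    obtain ⟨hfP, hPp⟩ := hP
    have hpp : (P.comap (algebraMap B C)).IsPrime := Ideal.comap_isPrime _ P
    have hfp : f ∈ P.comap (algebraMap B C) := hfP (Ideal.mem_span_singleton_self _)
    obtain ⟨p0, hp0, hfp0, hp0le, hp0m⟩ := ha' _ hpp ((Ideal.span_singleton_le_iff_mem _).mpr hfp)
      (fun hx => hunit P hPp (Ideal.mul_mem_right _ _ hx))
    rcases hIJ p0 hp0 hp0m ((Ideal.span_singleton_le_iff_mem _).mp hfp0) with hx | hx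
    · exact Ideal.mul_le_left.trans ((hle _ _).mpr (hx.trans hp0le))
    · exact Ideal.mul_le_right.trans ((hle _ _).mpr (hx.trans hp0le))
  · intro P hPp hIP hJP hfP
    rw [hle] at hIP hJP
    have hpp : (P.comap (algebraMap B C)).IsPrime := Ideal.comap_isPrime _ P
    obtain ⟨p0, hp0, hfp0, hp0le, hp0m⟩ := hb' _ hpp
      (sup_le (sup_le ((Ideal.span_singleton_le_iff_mem _).mpr hfP) hIP) hJP)
      (fun hx => hunit P hPp (Ideal.mul_mem_left _ _ hx))
    rw [sup_le_iff, sup_le_iff, Ideal.span_singleton_le_iff_mem] at hfp0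
    have e := hdim p0 hp0 hp0m hfp0.1.2 hfp0.2 hfp0.1.1
    have e2 : td K (B ⧸ P.comap g) ≤ td K (B ⧸ p0) :=
      td_le_of_surjective (trdeg_lt K _) (Ideal.Quotient.factorₐ K hp0le) (Ideal.Quotient.factor_surjective hp0le)
    have hpp' : (P.comap g).IsPrime := hpp
    have e3 : td K (B ⧸ P.comap g) = td K (C ⧸ P) := by
      refine td_loc (Ideal.quotientMapₐ P g le_rfl) (Ideal.quotientMap_injective' (H := le_rfl) le_rfl) ?_
      intro x
      obtain ⟨x, rfl⟩ := Ideal.Quotient.mk_surjective x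
      obtain ⟨n, d', hd⟩ := hfrac x
      refine ⟨Ideal.Quotient.mk _ (h ^ n), ?_, Ideal.Quotient.mk _ d', ?_⟩
      · rw [Ne, Ideal.Quotient.eq_zero_iff_mem]
        intro hx
        exact hunit P hPp (hpp'.mem_of_pow_mem n hx)
      · exact congrArg (Ideal.Quotient.mk P) hd
    omega
  · rw [hle, hcomap p1 hp1 h1]; exact hI
  · rw [hle, hcomap p2 hp2 h2]; exact hJ

theorem S1 {K A : Type*} [Field K] [CommRing A] [Algebra K A] {m : ℕ} (h : Good K A m)
    (𝔫 : Ideal A) [h𝔫 : 𝔫.IsPrime] (f : A) (I J : Ideal A) (hIfg : I.FG) (hJfg : J.FG)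
    (h1 : ∀ q : Ideal A, q.IsPrime → q ≤ 𝔫 → f ∈ q → I ≤ q ∨ J ≤ q)
    (h2 : ∀ q : Ideal A, q.IsPrime → q ≤ 𝔫 → f ∈ q → I ≤ q → J ≤ q → td K (A ⧸ q) + 3 ≤ m) :
    (∀ q : Ideal A, q.IsPrime → q ≤ 𝔫 → f ∈ q → I ≤ q) ∨ (∀ q : Ideal A, q.IsPrime → q ≤ 𝔫 → f ∈ q → J ≤ q) := by
  by_contra hcon
  push Not at hcon
  obtain ⟨⟨p1, hp1, hp1n, hfp1, hIp1⟩, p2, hp2, hp2n, hfp2, hJp2⟩ := hcon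
  have hA := h.dom
  have hf : f ≠ 0 := by
    rintro rfl
    rcases h1 ⊥ Ideal.isPrime_bot bot_le (Ideal.zero_mem _) with hx | hx
    · exact hIp1 (hx.trans bot_le)
    · exact hJp2 (hx.trans bot_le)
  classical
  obtain ⟨s, rfl⟩ := hIfg
  obtain ⟨t, rfl⟩ := hJfg
  obtain ⟨N, B, _, _, j, ι, hN, hBd, hBi, hBf, hj, hji, hι, hιi, hs⟩ := FL h (insert f (s ∪ t))
  choose! β hβ using hs
  have key : ∀ (q : Ideal A), q.IsPrime → ∀ a ∈ insert f (s ∪ t), (β a ∈ q.comap ι ↔ a ∈ q) := by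
    intro q hq a ha
    rw [Ideal.mem_comap, hβ a ha]
    exact hq.pow_mem_iff_mem N (Nat.pos_of_ne_zero hN)
  have keys : ∀ (q : Ideal A), q.IsPrime → ∀ u : Finset A, u ⊆ insert f (s ∪ t) →
      (Ideal.span (β '' (u : Set A)) ≤ q.comap ι ↔ Ideal.span (u : Set A) ≤ q) := by
    intro q hq u hu
    rw [Ideal.span_le, Ideal.span_le]
    constructor
    · intro hx a ha
      exact (key q hq a (hu ha)).mp (hx ⟨a, ha, rfl⟩)
    · rintro hx _ ⟨a, ha, rfl⟩
      exact (key q hq a (hu ha)).mpr (hx ha)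
  have hsS : s ⊆ insert f (s ∪ t) := fun x hx => by simp [hx]
  have htS : t ⊆ insert f (s ∪ t) := fun x hx => by simp [hx]
  have hfS : f ∈ insert f (s ∪ t) := by simp
  have hmp : (𝔫.comap ι).IsPrime := Ideal.comap_isPrime ι 𝔫
  have hp1' : (p1.comap ι).IsPrime := Ideal.comap_isPrime ι p1
  have hp2' : (p2.comap ι).IsPrime := Ideal.comap_isPrime ι p2
  have htd : td K B = m := by rw [td_eq_of_isIntegral ι hι hιi, h.td_eq]
  refine ONE_loc (K := K) hBf (β f) ?_ (Ideal.span (β '' (s : Set A))) (Ideal.span (β '' (t : Set A))) (𝔫.comap ι)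
    ?_ ?_ (p1.comap ι) (p2.comap ι) (Ideal.comap_mono hp1n) (Ideal.comap_mono hp2n)
    ((key p1 hp1 f hfS).mpr hfp1) ((key p2 hp2 f hfS).mpr hfp2)
    (fun hx => hIp1 ((keys p1 hp1 s hsS).mp hx)) (fun hx => hJp2 ((keys p2 hp2 t htS).mp hx))
  · intro h0
    have := hβ f hfS
    rw [h0, map_zero] at this
    exact pow_ne_zero N hf this.symm
  · intro p hp hpm hfp
    obtain ⟨q, hq, hqp, hc⟩ := going_down_int ι.toRingHom hι hιi p 𝔫 hpm
    have hc' : q.comap ι = p := hc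
    rw [← hc'] at hfp ⊢
    rw [keys q hqp s hsS, keys q hqp t htS]
    exact h1 q hqp hq ((key q hqp f hfS).mp hfp)
  · intro p hp hpm hIp hJp hfp
    obtain ⟨q, hq, hqp, hc⟩ := going_down_int ι.toRingHom hι hιi p 𝔫 hpm
    have hc' : q.comap ι = p := hc
    rw [← hc'] at hfp hIp hJp ⊢
    rw [td_quot_comap ι q (isIntegral_mk_comp ι.toRingHom hιi q), htd]
    exact h2 q hqp hq ((key q hqp f hfS).mp hfp) ((keys q hqp s hsS).mp hIp) ((keys q hqp t htS).mp hJp)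

end P10
end GK

namespace GK
section P11

theorem oka_cover {A : Type*} [CommRing A] (f : A) (T : Ideal A → Prop) (hT : T ⊤)
    (hmul : ∀ s t, T s → T t → T (s * t)) (hfg : ∀ t, T t → t.FG)
    (hp : ∀ q : Ideal A, q.IsPrime → f ∈ q → ∃ t, T t ∧ t ≤ q) (X : Ideal A) (hX : f ∈ X) :
    ∃ t, T t ∧ t ≤ X := by
  have hok : Ideal.IsOka (fun X : Ideal A => f ∈ X → ∃ t, T t ∧ t ≤ X) := by
    refine ⟨fun _ => ⟨⊤, hT, le_rfl⟩, ?_⟩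
    intro I a h1 h2 hf
    obtain ⟨t, ht, hle⟩ := h1 (Ideal.mem_sup_left hf)
    obtain ⟨t', ht', hle'⟩ := h2 (Ideal.le_colon hf)
    refine ⟨t * t', hmul _ _ ht ht', ?_⟩
    rw [Ideal.mul_le]
    intro r hr s hs
    obtain ⟨x, hx, y, hy, rfl⟩ := Submodule.mem_sup.mp (hle hr)
    obtain ⟨c, rfl⟩ := Ideal.mem_span_singleton'.mp hy
    have := Ideal.mem_colon_span_singleton.mp (hle' hs)
    rw [add_mul]
    refine I.add_mem (I.mul_mem_right _ hx) ?_
    rw [mul_assoc, mul_comm a s]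
    exact I.mul_mem_left _ this
  refine hok.forall_of_forall_prime' ?_ (fun q hq hf => hp q hq hf) X hX
  intro C hC hchain Y hY hsup
  by_cases hall : ∃ I ∈ C, f ∉ I
  · obtain ⟨I, hI, hf⟩ := hall
    exact ⟨I, hI, fun h => (hf h).elim⟩
  · push Not at hall
    obtain ⟨t, ht, hle⟩ := hsup (le_sSup hY (hall Y hY))
    have hc := (Submodule.fg_iff_compact t).mp (hfg t ht)
    obtain ⟨I, hI, htI⟩ := (CompleteLattice.isCompactElement_iff_le_of_directed_sSup_le _ t).mp hc C ⟨Y, hY⟩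
      hchain.directedOn hle
    exact ⟨I, hI, fun _ => ⟨t, ht, htI⟩⟩

theorem fg_sub {A : Type*} [CommRing A] (𝔫 : Ideal A) [𝔫.IsPrime] (I X Y : Ideal A) (hI : I.FG)
    (h : ∀ q : Ideal A, q.IsPrime → q ≤ 𝔫 → X ≤ q → Y ≤ q → I ≤ q) :
    ∃ 𝔟 : Ideal A, 𝔟.FG ∧ 𝔟 ≤ X ∧ ∀ q : Ideal A, q.IsPrime → q ≤ 𝔫 → 𝔟 ≤ q → Y ≤ q → I ≤ q := by
  classical
  obtain ⟨s, rfl⟩ := hI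
  have key : ∀ i ∈ s, ∃ p ∈ X, ∃ c, c ∉ 𝔫 ∧ ∃ n : ℕ, ∃ y ∈ Y, p + y = c * i ^ n := by
    intro i hi
    by_contra hcon
    push Not at hcon
    obtain ⟨q, hq, hle, hd⟩ := Ideal.exists_le_prime_disjoint (X ⊔ Y) (𝔫.primeCompl ⊔ Submonoid.powers i) (by
      rw [Set.disjoint_left]
      intro z hz hz'
      obtain ⟨x, hx, y, hy, rfl⟩ := Submodule.mem_sup.mp hz
      obtain ⟨c, hc, _, ⟨n, rfl⟩, hcn⟩ := Submonoid.mem_sup.mp hz'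
      exact hcon x hx c hc n y hy hcn.symm)
    rw [Set.disjoint_left] at hd
    have hqn : q ≤ 𝔫 := by
      intro z hz
      by_contra hzn
      exact hd hz (Submonoid.mem_sup_left (S := 𝔫.primeCompl) hzn)
    exact hd (h q hq hqn (le_sup_left.trans hle) (le_sup_right.trans hle) (Ideal.subset_span hi))
      (Submonoid.mem_sup_right (Submonoid.mem_powers i))
  choose! p hp c hc n y hy he using key
  refine ⟨Ideal.span (p '' s), ⟨s.image p, by simp⟩, ?_, ?_⟩
  · rw [Ideal.span_le]
    rintro _ ⟨i, hi, rfl⟩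
    exact hp i hi
  · intro q hq hqn hb hY
    rw [Ideal.span_le]
    intro i hi
    have h1 : c i * i ^ n i ∈ q := by
      rw [← he i hi]
      exact q.add_mem (hb (Ideal.subset_span ⟨i, hi, rfl⟩)) (hY (hy i hi))
    rcases hq.mem_or_mem h1 with h2 | h2
    · exact (hc i hi (hqn h2)).elim
    · exact hq.mem_of_pow_mem _ h2

theorem td_mk_comap {K A : Type*} [Field K] [CommRing A] [Algebra K A] (q : Ideal A) (P : Ideal (A ⧸ q)) [P.IsPrime] :
    td K (A ⧸ P.comap (Ideal.Quotient.mk q)) = td K ((A ⧸ q) ⧸ P) :=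
  td_quot_comap (Ideal.Quotient.mkₐ K q) P (RingHom.isIntegral_of_surjective _
    (Ideal.Quotient.mk_surjective.comp Ideal.Quotient.mk_surjective))

theorem Dn {K A : Type*} [Field K] [CommRing A] [Algebra K A] {m : ℕ} (h : Good K A m)
    (𝔫 : Ideal A) [𝔫.IsPrime] (q : Ideal A) [hq : q.IsPrime] (hqn : q ≤ 𝔫) (gs : List A) (hgs : ∀ g ∈ gs, g ∈ 𝔫) :
    ∃ q' : Ideal A, q'.IsPrime ∧ q ≤ q' ∧ q' ≤ 𝔫 ∧ (∀ g ∈ gs, g ∈ q') ∧ td K (A ⧸ q) ≤ td K (A ⧸ q') + gs.length := by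
  induction gs with
  | nil => exact ⟨q, hq, le_rfl, hqn, by simp, by simp⟩
  | cons g gs ih =>
    obtain ⟨q', hq', h1, h2, h3, h4⟩ := ih fun x hx => hgs x (List.mem_cons_of_mem _ hx)
    have hs : Function.Surjective (Ideal.Quotient.mk q') := Ideal.Quotient.mk_surjective
    have hker : RingHom.ker (Ideal.Quotient.mk q') ≤ 𝔫 := by rwa [Ideal.mk_ker]
    have hn' : (𝔫.map (Ideal.Quotient.mk q')).IsPrime := Ideal.map_isPrime_of_surjective hs hker
    have hcm : (𝔫.map (Ideal.Quotient.mk q')).comap (Ideal.Quotient.mk q') = 𝔫 := by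
      rw [Ideal.comap_map_of_surjective' _ hs, sup_eq_left]; exact hker
    obtain ⟨P, hP, hPle⟩ := Ideal.exists_minimalPrimes_le (I := Ideal.span {Ideal.Quotient.mk q' g})
      (J := 𝔫.map (Ideal.Quotient.mk q'))
      ((Ideal.span_singleton_le_iff_mem _).mpr (Ideal.mem_map_of_mem _ (hgs g (by simp))))
    have hPp : P.IsPrime := hP.1.1
    have hle : q' ≤ P.comap (Ideal.Quotient.mk q') := fun x hx => by
      rw [Ideal.mem_comap, Ideal.Quotient.eq_zero_iff_mem.mpr hx]; exact P.zero_mem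
    have e := D1 (h.quot q') _ P hP
    rw [← td_mk_comap] at e
    refine ⟨P.comap (Ideal.Quotient.mk q'), Ideal.comap_isPrime _ _, h1.trans hle, ?_, ?_, ?_⟩
    · rw [← hcm]; exact Ideal.comap_mono hPle
    · intro x hx
      rcases List.mem_cons.mp hx with rfl | hx
      · exact hP.1.2 (Ideal.mem_span_singleton_self _)
      · exact hle (h3 x hx)
    · simp only [List.length_cons]; omega

universe u v

theorem SR {K : Type v} [Field K] (r : ℕ) : ∀ {A : Type u} [CommRing A] [Algebra K A] {m : ℕ} (h : Good K A m)
    (𝔫 : Ideal A) [h𝔫 : 𝔫.IsPrime] (fs : List A) (hr : fs.length = r) (I J : Ideal A) (hIfg : I.FG) (hJfg : J.FG)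
    (h1 : ∀ q : Ideal A, q.IsPrime → q ≤ 𝔫 → (∀ f ∈ fs, f ∈ q) → I ≤ q ∨ J ≤ q)
    (h2 : ∀ q : Ideal A, q.IsPrime → q ≤ 𝔫 → (∀ f ∈ fs, f ∈ q) → I ≤ q → J ≤ q → td K (A ⧸ q) + r + 2 ≤ m),
    (∀ q : Ideal A, q.IsPrime → q ≤ 𝔫 → (∀ f ∈ fs, f ∈ q) → I ≤ q) ∨
    (∀ q : Ideal A, q.IsPrime → q ≤ 𝔫 → (∀ f ∈ fs, f ∈ q) → J ≤ q) := by
  induction r with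
  | zero =>
    intro A _ _ m h 𝔫 h𝔫 fs hr I J hIfg hJfg h1 h2
    have := h.dom
    rw [List.length_eq_zero_iff] at hr
    subst hr
    rcases h1 ⊥ Ideal.isPrime_bot bot_le (by simp) with hx | hx
    · exact Or.inl fun q _ _ _ => hx.trans bot_le
    · exact Or.inr fun q _ _ _ => hx.trans bot_le
  | succ r ih =>
    intro A _ _ m h 𝔫 h𝔫 fs hr I J hIfg hJfg h1 h2
    by_cases hfn : ∀ f ∈ fs, f ∈ 𝔫
    swap
    · exact Or.inl fun q hq hqn hf => (hfn fun f hfm => hqn (hf f hfm)).elim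
    obtain ⟨f, gs, rfl⟩ : ∃ f gs, fs = f :: gs := by
      cases fs with
      | nil => simp at hr
      | cons f gs => exact ⟨f, gs, rfl⟩
    simp only [List.length_cons, Nat.add_right_cancel_iff] at hr
    simp only [List.mem_cons, forall_eq_or_imp] at h1 h2 hfn ⊢
    have hspan : ∀ q : Ideal A, Ideal.span {x | x ∈ gs} ≤ q ↔ ∀ g ∈ gs, g ∈ q := fun q => Ideal.span_le
    let F : Ideal A → Ideal A → Prop := fun I 𝔟 => 𝔟.FG ∧
      ∀ q : Ideal A, q.IsPrime → q ≤ 𝔫 → 𝔟 ≤ q → (∀ g ∈ gs, g ∈ q) → I ≤ q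
    have hFtop : ∀ I, F I ⊤ := fun I => ⟨Ideal.fg_top A, fun q hq _ ht => (hq.ne_top (top_le_iff.mp ht)).elim⟩
    have hFmul : ∀ I s t, F I s → F I t → F I (s * t) := by
      intro I s t hs ht
      refine ⟨hs.1.mul ht.1, fun q hq hqn hle hg => ?_⟩
      rcases hq.mul_le.mp hle with hx | hx
      · exact hs.2 q hq hqn hx hg
      · exact ht.2 q hq hqn hx hg
    have hFs : ∀ I, ∀ a ∉ 𝔫, F I (Ideal.span {a}) := fun I a ha =>
      ⟨⟨{a}, by simp⟩, fun q _ hqn hle => (ha (hqn ((Ideal.span_singleton_le_iff_mem _).mp hle))).elim⟩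
    have hcov : ∀ q : Ideal A, q.IsPrime → f ∈ q → ∃ t, (∃ 𝔟 𝔠, F I 𝔟 ∧ F J 𝔠 ∧ t = 𝔟 * 𝔠) ∧ t ≤ q := by
      intro q hq hfq
      by_cases hqn : q ≤ 𝔫
      swap
      · obtain ⟨a, haq, han⟩ := Set.not_subset.mp hqn
        exact ⟨_, ⟨Ideal.span {a}, ⊤, hFs I a han, hFtop J, rfl⟩,
          Ideal.mul_le_left.trans ((Ideal.span_singleton_le_iff_mem _).mpr haq)⟩
      obtain ⟨P, hP, hPq⟩ := Ideal.exists_minimalPrimes_le (I := Ideal.span {f}) (J := q)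
        ((Ideal.span_singleton_le_iff_mem _).mpr hfq)
      have hPp : P.IsPrime := hP.1.1
      have hfP : f ∈ P := hP.1.2 (Ideal.mem_span_singleton_self _)
      have hPn : P ≤ 𝔫 := hPq.trans hqn
      have hs : Function.Surjective (Ideal.Quotient.mk P) := Ideal.Quotient.mk_surjective
      have hker : RingHom.ker (Ideal.Quotient.mk P) ≤ 𝔫 := by rwa [Ideal.mk_ker]
      have hn' : (𝔫.map (Ideal.Quotient.mk P)).IsPrime := Ideal.map_isPrime_of_surjective hs hker
      have hcm : (𝔫.map (Ideal.Quotient.mk P)).comap (Ideal.Quotient.mk P) = 𝔫 := by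
        rw [Ideal.comap_map_of_surjective' _ hs, sup_eq_left]; exact hker
      have e := D1 h f P hP
      have hPle : ∀ Q : Ideal (A ⧸ P), P ≤ Q.comap (Ideal.Quotient.mk P) := fun Q x hx => by
        rw [Ideal.mem_comap, Ideal.Quotient.eq_zero_iff_mem.mpr hx]; exact Q.zero_mem
      have hle : ∀ Q : Ideal (A ⧸ P), Q ≤ 𝔫.map (Ideal.Quotient.mk P) → Q.comap (Ideal.Quotient.mk P) ≤ 𝔫 := by
        intro Q hQ
        rw [← hcm]; exact Ideal.comap_mono hQ
      have hmem : ∀ Q : Ideal (A ⧸ P), (∀ g ∈ gs.map (Ideal.Quotient.mk P), g ∈ Q) ↔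
          ∀ g ∈ gs, g ∈ Q.comap (Ideal.Quotient.mk P) := by
        intro Q; simp
      have hS := ih (h.quot P) (𝔫.map (Ideal.Quotient.mk P)) (gs.map (Ideal.Quotient.mk P)) (by simpa using hr)
        (I.map (Ideal.Quotient.mk P)) (J.map (Ideal.Quotient.mk P)) (hIfg.map _) (hJfg.map _)
        (by
          intro Q hQ hQn hg
          rw [Ideal.map_le_iff_le_comap, Ideal.map_le_iff_le_comap]
          exact h1 _ (Ideal.comap_isPrime _ _) (hle Q hQn) ⟨hPle Q hfP, (hmem Q).mp hg⟩)
        (by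
          intro Q hQ hQn hg hI hJ
          rw [Ideal.map_le_iff_le_comap] at hI hJ
          have := h2 _ (Ideal.comap_isPrime _ _) (hle Q hQn) ⟨hPle Q hfP, (hmem Q).mp hg⟩ hI hJ
          rw [td_mk_comap] at this
          omega)
      have back : ∀ I : Ideal A, (∀ Q : Ideal (A ⧸ P), Q.IsPrime → Q ≤ 𝔫.map (Ideal.Quotient.mk P) →
          (∀ g ∈ gs.map (Ideal.Quotient.mk P), g ∈ Q) → I.map (Ideal.Quotient.mk P) ≤ Q) →
          ∀ q : Ideal A, q.IsPrime → q ≤ 𝔫 → P ≤ q → Ideal.span {x | x ∈ gs} ≤ q → I ≤ q := by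
        intro I hI q hq hqn hPq hg
        rw [hspan] at hg
        have hcq : (q.map (Ideal.Quotient.mk P)).comap (Ideal.Quotient.mk P) = q := by
          rw [Ideal.comap_map_of_surjective' _ hs, sup_eq_left, Ideal.mk_ker]; exact hPq
        have := hI (q.map (Ideal.Quotient.mk P)) (Ideal.map_isPrime_of_surjective hs (by rwa [Ideal.mk_ker]))
          (Ideal.map_mono hqn) (by rw [hmem, hcq]; exact hg)
        rwa [Ideal.map_le_iff_le_comap, hcq] at this
      rcases hS with hS | hS
      · obtain ⟨𝔟, hb1, hb2, hb3⟩ := fg_sub 𝔫 I P (Ideal.span {x | x ∈ gs}) hIfg (back I hS)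
        exact ⟨_, ⟨𝔟, ⊤, ⟨hb1, fun q hq hqn hbq hg => hb3 q hq hqn hbq ((hspan q).mpr hg)⟩, hFtop J, rfl⟩,
          Ideal.mul_le_left.trans (hb2.trans hPq)⟩
      · obtain ⟨𝔟, hb1, hb2, hb3⟩ := fg_sub 𝔫 J P (Ideal.span {x | x ∈ gs}) hJfg (back J hS)
        exact ⟨_, ⟨⊤, 𝔟, hFtop I, ⟨hb1, fun q hq hqn hbq hg => hb3 q hq hqn hbq ((hspan q).mpr hg)⟩, rfl⟩,
          Ideal.mul_le_right.trans (hb2.trans hPq)⟩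
    obtain ⟨t, ⟨I₁, J₁, hI₁, hJ₁, rfl⟩, ht⟩ := oka_cover f (fun t => ∃ 𝔟 𝔠, F I 𝔟 ∧ F J 𝔠 ∧ t = 𝔟 * 𝔠)
      ⟨⊤, ⊤, hFtop I, hFtop J, by simp⟩
      (by
        rintro _ _ ⟨b, c, hb, hc, rfl⟩ ⟨b', c', hb', hc', rfl⟩
        exact ⟨b * b', c * c', hFmul _ _ _ hb hb', hFmul _ _ _ hc hc', by ring⟩)
      (by
        rintro _ ⟨b, c, hb, hc, rfl⟩
        exact hb.1.mul hc.1)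
      hcov (Ideal.span {f}) (Ideal.mem_span_singleton_self _)
    have hS1 := S1 h 𝔫 f I₁ J₁ hI₁.1 hJ₁.1
      (by
        intro q hq _ hf
        exact hq.mul_le.mp (ht.trans ((Ideal.span_singleton_le_iff_mem _).mpr hf)))
      (by
        intro q hq hqn hf hIq hJq
        obtain ⟨q', hq', h3, h4, h5, h6⟩ := Dn h 𝔫 q hqn gs hfn.2
        have := h2 q' hq' h4 ⟨h3 hf, h5⟩ (hI₁.2 q' hq' h4 (hIq.trans h3) h5) (hJ₁.2 q' hq' h4 (hJq.trans h3) h5)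
        omega)
    rcases hS1 with hS | hS
    · exact Or.inl fun q hq hqn hf => hI₁.2 q hq hqn (hS q hq hqn hf.1) hf.2
    · exact Or.inr fun q hq hqn hf => hJ₁.2 q hq hqn (hS q hq hqn hf.1) hf.2

end P11
end GK

namespace GK
section P12

theorem point_of_max {K R : Type*} [Field K] [IsAlgClosed K] [CommRing R] [Algebra K R] (hfg : Algebra.FiniteType K R)
    (m : Ideal R) [hm : m.IsMaximal] : ∃ x : R →ₐ[K] K, RingHom.ker x = m := by
  let _ : Field (R ⧸ m) := Ideal.Quotient.field m
  have : Algebra.FiniteType K (R ⧸ m) := inferInstance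
  have : Module.Finite K (R ⧸ m) := finite_of_finite_type_of_isJacobsonRing K (R ⧸ m)
  have hb := IsAlgClosed.algebraMap_bijective_of_isIntegral (k := K) (K := R ⧸ m)
  let e : K ≃ₐ[K] (R ⧸ m) := AlgEquiv.ofBijective (Algebra.ofId K (R ⧸ m)) hb
  refine ⟨e.symm.toAlgHom.comp (Ideal.Quotient.mkₐ K m), ?_⟩
  ext z
  simp [RingHom.mem_ker, Ideal.Quotient.eq_zero_iff_mem]

theorem exists_point {K R : Type*} [Field K] [IsAlgClosed K] [CommRing R] [Algebra K R] (hfg : Algebra.FiniteType K R)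
    (p : Ideal R) [hp : p.IsPrime] (a : R) (ha : a ∉ p) : ∃ x : R →ₐ[K] K, p ≤ RingHom.ker x ∧ x a ≠ 0 := by
  have : IsJacobsonRing R := isJacobsonRing_of_finiteType (A := K)
  have hj : p.jacobson = p := IsJacobsonRing.out this hp.isRadical
  rw [← hj, Ideal.jacobson, Ideal.mem_sInf] at ha
  push Not at ha
  obtain ⟨m, ⟨hpm, hm⟩, ham⟩ := ha
  obtain ⟨x, hx⟩ := point_of_max hfg m
  refine ⟨x, by rw [hx]; exact hpm, fun h => ham ?_⟩
  rw [← hx]; exact h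

theorem tensor_domain {K R T : Type*} [Field K] [IsAlgClosed K] [CommRing R] [Algebra K R] [IsDomain R]
    (hfg : Algebra.FiniteType K R) [CommRing T] [Algebra K T] [IsDomain T] : IsDomain (R ⊗[K] T) := by
  have : Nontrivial (R ⊗[K] T) := inferInstance
  refine @NoZeroDivisors.to_isDomain _ _ _ ⟨?_⟩
  intro a b hab
  let bT := Module.Free.chooseBasis K T
  let B := bT.baseChange R
  let ev : (R →ₐ[K] K) → (R ⊗[K] T →ₐ[K] T) := fun x =>
    Algebra.TensorProduct.lift ((Algebra.ofId K T).comp x) (AlgHom.id K T) (fun _ _ => Commute.all _ _)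
  have hev : ∀ x (c : R ⊗[K] T) i, bT.repr (ev x c) i = x (B.repr c i) := by
    intro x c i
    induction c with
    | zero => simp
    | add u v hu hv => simp [hu, hv]
    | tmul r t =>
      have : ev x (r ⊗ₜ t) = x r • t := by simp [ev, Algebra.ofId_apply, Algebra.smul_def]
      rw [this]
      simp [B, mul_comm]
  by_contra hcon
  push Not at hcon
  obtain ⟨ha, hb⟩ := hcon
  have h0 : ∀ c : R ⊗[K] T, c ≠ 0 → ∃ i, B.repr c i ≠ 0 := by
    intro c hc
    by_contra h
    push Not at h
    exact hc (B.repr.map_eq_zero_iff.mp (Finsupp.ext h))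
  obtain ⟨i, hi⟩ := h0 a ha
  obtain ⟨j, hj⟩ := h0 b hb
  obtain ⟨x, -, hx⟩ := exists_point (K := K) hfg ⊥ (B.repr a i * B.repr b j) (by simpa using ⟨hi, hj⟩)
  have h1 : ev x a * ev x b = 0 := by rw [← map_mul, hab, map_zero]
  rw [map_mul] at hx
  rcases mul_eq_zero.mp h1 with h | h
  · apply hx; rw [← hev x a i, h]; simp
  · apply hx; rw [← hev x b j, h]; simp

theorem mv_normal (n : ℕ) {R : Type*} [CommRing R] [IsDomain R] [IsIntegrallyClosed R] :
    IsIntegrallyClosed (MvPolynomial (Fin n) R) := by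
  induction n with
  | zero => exact IsIntegrallyClosed.of_equiv (MvPolynomial.isEmptyRingEquiv R (Fin 0)).symm
  | succ n ih => exact IsIntegrallyClosed.of_equiv (MvPolynomial.finSuccEquiv R n).symm.toRingEquiv

theorem etale_normal {N S : Type*} [CommRing N] [IsDomain N] [IsIntegrallyClosed N] [CommRing S] [IsDomain S]
    [Algebra N S] [Algebra.Etale N S] (hinj : Function.Injective (algebraMap N S)) : IsIntegrallyClosed S := by
  let L := FractionRing N
  let W := S ⊗[N] L
  let M := Algebra.algebraMapSubmonoid S (nonZeroDivisors N)
  have hloc : IsLocalization M W := IsLocalization.tensor L (nonZeroDivisors N)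
  have hM : M ≤ nonZeroDivisors S := by
    rintro _ ⟨a, ha, rfl⟩
    exact mem_nonZeroDivisors_of_ne_zero fun h =>
      nonZeroDivisors.ne_zero ha (hinj (by rw [map_zero]; exact h))
  have hWd : IsDomain W := IsLocalization.isDomain_of_le_nonZeroDivisors _ hM
  have hWinj : Function.Injective (algebraMap S W) := IsLocalization.injective W hM
  let c : W ≃ₐ[N] (L ⊗[N] S) := Algebra.TensorProduct.comm N S L
  have hWd' : IsDomain (L ⊗[N] S) := c.symm.toMulEquiv.isDomain _
  have : Module.Finite L (L ⊗[N] S) := Algebra.FormallyUnramified.finite_of_free _ _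
  have hf' : IsField (L ⊗[N] S) := isField_of_isIntegral_of_isField' (Field.toIsField L)
  have hf : IsField W := c.toMulEquiv.isField hf'
  let _ : Field W := hf.toField
  have hfs : FaithfulSMul S W := (faithfulSMul_iff_algebraMap_injective S W).mpr hWinj
  have hfr : IsFractionRing S W := IsFractionRing.of_field S W fun z => by
    obtain ⟨⟨x, y⟩, hxy⟩ := IsLocalization.surj M z
    refine ⟨x, y, ?_⟩
    rw [eq_div_iff]
    · exact hxy
    · exact (IsLocalization.map_units W y).ne_zero
  rw [isIntegrallyClosed_iff W]
  intro z hz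
  have hb := TensorProduct.toIntegralClosure_bijective_of_smooth (R := N) (S := S) (B := L)
  obtain ⟨w, hw⟩ := hb.2 ⟨z, hz⟩
  have hw' : Algebra.TensorProduct.map (AlgHom.id S S) (integralClosure N L).val w = z :=
    congrArg Subtype.val hw
  rw [← hw']
  clear hw hw' hz
  induction w with
  | zero => exact ⟨0, by simp⟩
  | add x y hx hy =>
    obtain ⟨a, ha⟩ := hx
    obtain ⟨b, hb⟩ := hy
    exact ⟨a + b, by rw [map_add, map_add, ha, hb]⟩
  | tmul s l =>
    obtain ⟨l, hl⟩ := l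
    obtain ⟨d, rfl⟩ := (isIntegrallyClosed_iff L).mp inferInstance hl
    refine ⟨s * algebraMap N S d, ?_⟩
    simp only [Algebra.TensorProduct.map_tmul, AlgHom.coe_id, id_eq, Subalgebra.coe_val]
    rw [Algebra.TensorProduct.algebraMap_apply, Algebra.algebraMap_self_apply, mul_comm,
      ← Algebra.smul_def, TensorProduct.smul_tmul, Algebra.algebraMap_eq_smul_one]

theorem base_normal {P N T : Type*} [CommRing P] [CommRing N] [IsDomain N] [IsIntegrallyClosed N] [Algebra P N]
    [CommRing T] [Algebra P T] [Module.Flat P N] [Algebra.Etale P T] (hi : Function.Injective (algebraMap P T))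
    [IsDomain (N ⊗[P] T)] : IsIntegrallyClosed (N ⊗[P] T) := by
  have hinj0 := Algebra.TensorProduct.includeLeft_injective (R := P) (S := P) (A := N) (B := T) hi
  exact etale_normal (N := N) (S := N ⊗[P] T) hinj0

theorem loc_tensor_normal {K N T : Type*} [Field K] [IsAlgClosed K] [CommRing N] [IsDomain N] [IsIntegrallyClosed N]
    [Algebra K N] [CommRing T] [IsDomain T] [Algebra K T] (hT : Algebra.FiniteType K T) (n : ℕ)
    [Algebra (MvPolynomial (Fin n) K) T] [IsScalarTower K (MvPolynomial (Fin n) K) T]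
    [Algebra.Etale (MvPolynomial (Fin n) K) T] : IsIntegrallyClosed (T ⊗[K] N) := by
  have hd : IsDomain (T ⊗[K] N) := tensor_domain hT
  let Pn := MvPolynomial (Fin n) K ⊗[K] N
  let e : Pn ≃+* MvPolynomial (Fin n) N := (Algebra.TensorProduct.comm K _ N).toRingEquiv.trans
    (MvPolynomial.algebraTensorAlgEquiv (σ := Fin n) K N).toRingEquiv
  have : IsDomain Pn := e.toMulEquiv.isDomain _
  have := mv_normal n (R := N)
  have : IsIntegrallyClosed Pn := IsIntegrallyClosed.of_equiv e.symm
  let S' := Pn ⊗[MvPolynomial (Fin n) K] T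
  let e2 : S' ≃+* T ⊗[K] N := (Algebra.TensorProduct.comm (MvPolynomial (Fin n) K) Pn T).toRingEquiv.trans
    (Algebra.TensorProduct.cancelBaseChange K (MvPolynomial (Fin n) K) (MvPolynomial (Fin n) K) T N).toRingEquiv
  have : IsDomain S' := e2.toMulEquiv.isDomain _
  have : Module.IsTorsionFree (MvPolynomial (Fin n) K) T := inferInstance
  have hi : Function.Injective (algebraMap (MvPolynomial (Fin n) K) T) := FaithfulSMul.algebraMap_injective _ _
  have : IsIntegrallyClosed S' := base_normal hi
  exact IsIntegrallyClosed.of_equiv (R := Pn ⊗[MvPolynomial (Fin n) K] T) (S := T ⊗[K] N) e2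

theorem frac_mem {D Q : Type*} [CommRing D] [IsDomain D] [IsIntegrallyClosed D] [Field Q] (g : D →+* Q)
    (hg : Function.Injective g) (z : Q) (a b : D) (hb : g b ≠ 0) (hz : z * g b = g a) (hi : g.IsIntegralElem z) :
    ∃ d, g d = z := by
  algebraize [g]
  let L := FractionRing D
  let l : L →ₐ[D] Q := IsFractionRing.liftAlgHom (g := Algebra.ofId D Q) hg
  have hl : Function.Injective l := l.toRingHom.injective
  have hw : l (algebraMap D L a / algebraMap D L b) = z := by
    rw [map_div₀, l.commutes, l.commutes, div_eq_iff]
    · exact hz.symm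
    · exact hb
  have hi' : IsIntegral D z := hi
  rw [← hw, isIntegral_algHom_iff l hl] at hi'
  obtain ⟨d, hd⟩ := (isIntegrallyClosed_iff L).mp inferInstance hi'
  refine ⟨d, ?_⟩
  rw [← hw, ← hd, l.commutes]
  rfl

theorem tensor_normal {K R : Type*} [Field K] [IsAlgClosed K] [CommRing R] [IsDomain R] [IsIntegrallyClosed R]
    [Algebra K R] (hfg : Algebra.FiniteType K R) : IsIntegrallyClosed (R ⊗[K] R) := by
  have hSd : IsDomain (R ⊗[K] R) := tensor_domain hfg
  have hsm : Algebra.IsSmoothAt K (⊥ : Ideal R) := by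
    have h1 : Algebra.FormallySmooth K (FractionRing R) := inferInstance
    have h2 : (⊥ : Ideal R).primeCompl = nonZeroDivisors R := by
      ext x; simp [Ideal.primeCompl, mem_nonZeroDivisors_iff_ne_zero]
    have h3 : IsLocalization (⊥ : Ideal R).primeCompl (FractionRing R) := by rw [h2]; infer_instance
    exact Algebra.FormallySmooth.of_equiv
      ((IsLocalization.algEquiv (⊥ : Ideal R).primeCompl (FractionRing R)
        (Localization.AtPrime (⊥ : Ideal R))).restrictScalars K)
  have : Algebra.FinitePresentation K R := (Algebra.FinitePresentation.of_finiteType).mp hfg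
  obtain ⟨h, hh, n, hA, hst, het⟩ := Algebra.IsSmoothAt.exists_isStandardEtale_mvPolynomial (R := K) (p := (⊥ : Ideal R))
  have hh0 : h ≠ 0 := by simpa using hh
  let T := Localization.Away h
  have hM : Submonoid.powers h ≤ nonZeroDivisors R := powers_le_nonZeroDivisors_of_noZeroDivisors hh0
  have hTd : IsDomain T := IsLocalization.isDomain_localization hM
  have hTfg : Algebra.FiniteType K T := Algebra.FiniteType.trans hfg inferInstance
  have hiT : Function.Injective (algebraMap R T) := IsLocalization.injective T hM
  have hTR : IsIntegrallyClosed (T ⊗[K] R) := loc_tensor_normal hTfg n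
  have hRT : IsIntegrallyClosed (R ⊗[K] T) :=
    IsIntegrallyClosed.of_equiv (Algebra.TensorProduct.comm K T R).toRingEquiv
  have hdTR : IsDomain (T ⊗[K] R) := tensor_domain hTfg
  have hdRT : IsDomain (R ⊗[K] T) := tensor_domain hfg
  have hdTT : IsDomain (T ⊗[K] T) := tensor_domain hTfg
  let i : R →ₐ[K] T := IsScalarTower.toAlgHom K R T
  have hi : Function.Injective i := hiT
  obtain ⟨π, hπ⟩ := i.toLinearMap.exists_leftInverse_of_injective (LinearMap.ker_eq_bot.mpr hi)
  have hπ' : ∀ x, π (i x) = x := fun x => LinearMap.congr_fun hπ x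
  let gS : R ⊗[K] R →ₐ[K] T ⊗[K] T := Algebra.TensorProduct.map i i
  let g1 : T ⊗[K] R →ₐ[K] T ⊗[K] T := Algebra.TensorProduct.map (AlgHom.id K T) i
  let g2 : R ⊗[K] T →ₐ[K] T ⊗[K] T := Algebra.TensorProduct.map i (AlgHom.id K T)
  let j1 : R ⊗[K] R →ₐ[K] T ⊗[K] R := Algebra.TensorProduct.map i (AlgHom.id K R)
  let j2 : R ⊗[K] R →ₐ[K] R ⊗[K] T := Algebra.TensorProduct.map (AlgHom.id K R) i
  have e1 : g1.comp j1 = gS := by ext <;> simp [g1, j1, gS]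
  have e2 : g2.comp j2 = gS := by ext <;> simp [g2, j2, gS]
  have hg1 : Function.Injective g1 := Module.Flat.lTensor_preserves_injective_linearMap (M := T) i.toLinearMap hi
  have hg2 : Function.Injective g2 := Module.Flat.rTensor_preserves_injective_linearMap (M := T) i.toLinearMap hi
  have hj1 : Function.Injective j1 := Module.Flat.rTensor_preserves_injective_linearMap (M := R) i.toLinearMap hi
  have hgS : Function.Injective gS := by rw [← e1]; exact hg1.comp hj1
  obtain ⟨Q, _, q, hq⟩ : ∃ (Q : Type _) (_ : Field Q) (q : T ⊗[K] T →+* Q), Function.Injective q :=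
    ⟨FractionRing (T ⊗[K] T), inferInstance, algebraMap _ _, IsFractionRing.injective _ _⟩
  rw [isIntegrallyClosed_iff (FractionRing (R ⊗[K] R))]
  intro z hz
  let l : FractionRing (R ⊗[K] R) →+* Q := IsFractionRing.lift (g := q.comp gS.toRingHom) (hq.comp hgS)
  have hl : ∀ s, l (algebraMap _ _ s) = q (gS s) := fun s => IsFractionRing.lift_algebraMap _ s
  obtain ⟨p, hpm, hp⟩ := hz
  have hint : (q.comp gS.toRingHom).IsIntegralElem (l z) := by
    refine ⟨p, hpm, ?_⟩
    have h1 : q.comp gS.toRingHom = l.comp (algebraMap _ _) := RingHom.ext fun s => (hl s).symm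
    rw [h1, ← Polynomial.hom_eval₂, hp, map_zero]
  obtain ⟨a, b, hb0, hzab⟩ := IsFractionRing.div_surjective (A := R ⊗[K] R) z
  have hb : q (gS b) ≠ 0 := by
    rw [Ne, map_eq_zero_iff q hq, map_eq_zero_iff gS hgS]
    exact nonZeroDivisors.ne_zero hb0
  have hzb : l z * q (gS b) = q (gS a) := by
    rw [← hzab, map_div₀, hl, hl, div_mul_cancel₀ _ hb]
  obtain ⟨u, hu⟩ := frac_mem (q.comp g1.toRingHom) (hq.comp hg1) (l z) (j1 a) (j1 b)
    (by have := DFunLike.congr_fun e1 b; simp only [AlgHom.comp_apply] at this; simpa [this] using hb)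
    (by
      have h1 := DFunLike.congr_fun e1 b
      have h2 := DFunLike.congr_fun e1 a
      simp only [AlgHom.comp_apply] at h1 h2
      simpa [h1, h2] using hzb)
    (by
      refine ⟨p.map j1.toRingHom, hpm.map _, ?_⟩
      rw [Polynomial.eval₂_map, RingHom.comp_assoc]
      have h3 : g1.toRingHom.comp j1.toRingHom = gS.toRingHom := congrArg AlgHom.toRingHom e1
      rw [h3]
      have h1 : q.comp gS.toRingHom = l.comp (algebraMap _ _) := RingHom.ext fun s => (hl s).symm
      rw [h1, ← Polynomial.hom_eval₂, hp, map_zero])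
  obtain ⟨v, hv⟩ := frac_mem (q.comp g2.toRingHom) (hq.comp hg2) (l z) (j2 a) (j2 b)
    (by have := DFunLike.congr_fun e2 b; simp only [AlgHom.comp_apply] at this; simpa [this] using hb)
    (by
      have h1 := DFunLike.congr_fun e2 b
      have h2 := DFunLike.congr_fun e2 a
      simp only [AlgHom.comp_apply] at h1 h2
      simpa [h1, h2] using hzb)
    (by
      refine ⟨p.map j2.toRingHom, hpm.map _, ?_⟩
      rw [Polynomial.eval₂_map, RingHom.comp_assoc]
      have h3 : g2.toRingHom.comp j2.toRingHom = gS.toRingHom := congrArg AlgHom.toRingHom e2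
      rw [h3]
      have h1 : q.comp gS.toRingHom = l.comp (algebraMap _ _) := RingHom.ext fun s => (hl s).symm
      rw [h1, ← Polynomial.hom_eval₂, hp, map_zero])
  have huv : g1 u = g2 v := hq (hu.trans hv.symm)
  have hk1 : ∀ u, TensorProduct.map LinearMap.id (i.toLinearMap ∘ₗ π) (g1 u) = g1 u := by
    intro u
    induction u with
    | zero => simp
    | add x y hx hy => rw [map_add, map_add, hx, hy]
    | tmul x y => simp [g1, hπ']
  have hk2 : ∀ v, TensorProduct.map (i.toLinearMap ∘ₗ π) LinearMap.id (g2 v) = g2 v := by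
    intro v
    induction v with
    | zero => simp
    | add x y hx hy => rw [map_add, map_add, hx, hy]
    | tmul x y => simp [g2, hπ']
  have hk : ∀ w : T ⊗[K] T, TensorProduct.map LinearMap.id (i.toLinearMap ∘ₗ π)
      (TensorProduct.map (i.toLinearMap ∘ₗ π) LinearMap.id w) = gS (TensorProduct.map π π w) := by
    intro w
    induction w with
    | zero => simp
    | add x y hx hy => simp only [map_add, hx, hy]
    | tmul x y => simp [gS]
  refine ⟨TensorProduct.map π π (g2 v), l.injective ?_⟩
  rw [hl, ← hk, hk2, ← huv, hk1]
  exact hu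

end P12
end GK

namespace GK
section P13

theorem noether {K S : Type*} [Field K] [CommRing S] [IsDomain S] [Algebra K S] (hfg : Algebra.FiniteType K S) :
    ∃ g : MvPolynomial (Fin (td K S)) K →ₐ[K] S, Function.Injective g ∧ g.toRingHom.IsIntegral := by
  obtain ⟨s, g, hg, hf⟩ := exists_finite_inj_algHom_of_fg K S
  have hi : g.toRingHom.IsIntegral := RingHom.Finite.to_isIntegral hf
  have : s = td K S := by rw [← td_eq_of_isIntegral g hg hi, td_mvPolynomial]
  subst this
  exact ⟨g, hg, hi⟩

theorem exists_good.{u} {K : Type*} {S : Type u} [Field K] [CommRing S] [IsDomain S] [Algebra K S] (hfg : Algebra.FiniteType K S) :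
    ∃ (A : Type u) (_ : CommRing A) (_ : Algebra K A) (g : S →ₐ[K] A), Function.Injective g ∧
      g.toRingHom.IsIntegral ∧ Good K A (td K S) := by
  let Ω := AlgebraicClosure (FractionRing S)
  let A := integralClosure S Ω
  have hint : Algebra.IsIntegral S A := inferInstance
  have hinj : Function.Injective (algebraMap S A) := by
    have h1 : Function.Injective (algebraMap S Ω) := by
      rw [IsScalarTower.algebraMap_eq S (FractionRing S) Ω]
      exact (algebraMap (FractionRing S) Ω).injective.comp (IsFractionRing.injective S (FractionRing S))
    have h2 : algebraMap S Ω = A.val.toRingHom.comp (algebraMap S A) := rfl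
    rw [h2] at h1
    exact fun a b h => h1 (congrArg Subtype.val h)
  let gA : S →ₐ[K] A := IsScalarTower.toAlgHom K S A
  have hgi : gA.toRingHom.IsIntegral := fun x => hint.isIntegral x
  obtain ⟨g, hg, hi⟩ := noether hfg
  refine ⟨↥A, inferInstance, inferInstance, gA, hinj, hgi, ⟨inferInstance, ⟨gA.comp g, hinj.comp hg, ?_⟩, ?_⟩⟩
  · exact RingHom.IsIntegral.trans g.toRingHom gA.toRingHom hi hgi
  · intro p hp hdeg
    obtain ⟨x, hx⟩ := IsAlgClosed.exists_root (p.map (algebraMap A Ω)) (by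
      rw [hp.degree_map, Polynomial.degree_eq_natDegree hp.ne_zero]
      exact_mod_cast hdeg)
    have hxA : IsIntegral A x := ⟨p, hp, by rw [← Polynomial.eval_map]; exact hx⟩
    have hxS : IsIntegral S x := isIntegral_trans x hxA
    refine ⟨⟨x, hxS⟩, ?_⟩
    have hinjA : Function.Injective (algebraMap A Ω) := Subtype.val_injective
    apply hinjA
    rw [map_zero]
    have := Polynomial.eval_map_apply (f := algebraMap A Ω) (p := p) (⟨x, hxS⟩ : A)
    rw [← this]
    exact hx

theorem td_drop {K R : Type*} [Field K] [CommRing R] [Algebra K R] (hfg : Algebra.FiniteType K R)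
    (Q P : Ideal R) [Q.IsPrime] [P.IsPrime] (h : Q < P) : td K (R ⧸ P) < td K (R ⧸ Q) := by
  obtain ⟨g, hg, hi⟩ := noether (K := K) (S := R ⧸ Q) inferInstance
  have hs : Function.Surjective (Ideal.Quotient.mk Q) := Ideal.Quotient.mk_surjective
  have hker : RingHom.ker (Ideal.Quotient.mk Q) ≤ P := by rw [Ideal.mk_ker]; exact h.le
  have hP' : (P.map (Ideal.Quotient.mk Q)).IsPrime := Ideal.map_isPrime_of_surjective hs hker
  have hcm : (P.map (Ideal.Quotient.mk Q)).comap (Ideal.Quotient.mk Q) = P := by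
    rw [Ideal.comap_map_of_surjective' _ hs, sup_eq_left]; exact hker
  have hne : P.map (Ideal.Quotient.mk Q) ≠ ⊥ := by
    intro h0
    rw [h0, ← RingHom.ker_eq_comap_bot, Ideal.mk_ker] at hcm
    exact h.ne hcm
  have := td_quot_lt' g hi _ hne
  rw [← td_mk_comap, hcm] at this
  exact this

theorem td_quot_le {K R : Type*} [Field K] [CommRing R] [IsDomain R] [Algebra K R] (hfg : Algebra.FiniteType K R)
    (P : Ideal R) : td K (R ⧸ P) ≤ td K R :=
  td_le_of_surjective (trdeg_lt K R) (Ideal.Quotient.mkₐ K P) Ideal.Quotient.mk_surjective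

theorem height_le_td {K R : Type*} [Field K] [CommRing R] [IsDomain R] [Algebra K R] (hfg : Algebra.FiniteType K R)
    (P : PrimeSpectrum R) : Order.height P ≤ ((td K R - td K (R ⧸ P.asIdeal) : ℕ) : ℕ∞) := by
  let f : PrimeSpectrum R → ℕ := fun p => td K R - td K (R ⧸ p.asIdeal)
  have hf : StrictMono f := by
    intro p q hpq
    have h1 := td_drop (K := K) hfg p.asIdeal q.asIdeal hpq
    have h2 := td_quot_le (K := K) hfg p.asIdeal
    simp only [f]; omega
  have := Order.height_le_height_apply_of_strictMono f hf P
  rwa [Order.height_nat] at this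

theorem dim_le_td {K R : Type*} [Field K] [CommRing R] [IsDomain R] [Algebra K R] (hfg : Algebra.FiniteType K R)
    (n : ℕ) (hn : ringKrullDim R = (n : WithBot ℕ∞)) : n ≤ td K R := by
  have h1 : ringKrullDim R ≤ ((td K R : ℕ∞) : WithBot ℕ∞) := by
    rw [ringKrullDim, Order.krullDim_eq_iSup_height]
    refine iSup_le fun p => ?_
    have := height_le_td (K := K) hfg p
    exact_mod_cast this.trans (by exact_mod_cast Nat.sub_le _ _)
  rw [hn] at h1
  exact_mod_cast h1

theorem nonrefl {K R G : Type*} [Field K] [CommRing R] [IsDomain R] [Algebra K R] [Group G]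
    (hfg : Algebra.FiniteType K R) (φ : G →* (R ≃ₐ[K] R)) (k : ℕ) (σ : G)
    (h : ¬ IsKReflection K R G φ (k : ℕ∞) σ) (P : Ideal R) [hP : P.IsPrime] (hle : ∀ f, φ σ f - f ∈ P) :
    td K (R ⧸ P) + k + 1 ≤ td K R := by
  rw [IsKReflection, not_le] at h
  let p : PrimeSpectrum R := ⟨P, hP⟩
  let p' : (Set.univ : Set (PrimeSpectrum R)) := ⟨p, trivial⟩
  have hp : p ∈ zeroLocus (reflIdeal K R G φ σ : Set R) := by
    rw [mem_zeroLocus]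
    change reflIdeal K R G φ σ ≤ P
    rw [reflIdeal, Ideal.span_le]
    rintro _ ⟨f, rfl⟩
    exact hle f
  have h1 : (k : ℕ∞) < Order.height p' :=
    lt_of_lt_of_le h (iInf_le (fun p : {q : (Set.univ : Set (PrimeSpectrum R)) //
      (q : PrimeSpectrum R) ∈ zeroLocus (reflIdeal K R G φ σ : Set R)} => Order.height (p : (Set.univ : Set (PrimeSpectrum R)))) ⟨p', hp⟩)
  have h2 : Order.height p' ≤ Order.height p :=
    Order.height_le_height_apply_of_strictMono (Subtype.val) (fun _ _ h => h) p'
  have h3 := (h1.trans_le h2).trans_le (height_le_td (K := K) hfg p)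
  have h4 : k < td K R - td K (R ⧸ P) := by exact_mod_cast h3
  omega

theorem tensor_ft {K R : Type*} [Field K] [CommRing R] [Algebra K R]
    (hfg : Algebra.FiniteType K R) : Algebra.FiniteType K (R ⊗[K] R) :=
  Algebra.FiniteType.trans hfg (inferInstance : Algebra.FiniteType R (R ⊗[K] R))

theorem td_tensor {K R : Type*} [Field K] [IsAlgClosed K] [CommRing R] [IsDomain R] [Algebra K R]
    (hfg : Algebra.FiniteType K R) : td K R + td K R ≤ td K (R ⊗[K] R) := by
  have hd : IsDomain (R ⊗[K] R) := tensor_domain hfg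
  have hft : Algebra.FiniteType K (R ⊗[K] R) := tensor_ft hfg
  obtain ⟨g, hg, -⟩ := noether hfg
  generalize td K R = d at g hg ⊢
  let e : MvPolynomial (Fin d ⊕ Fin d) K ≃ₐ[K] MvPolynomial (Fin d) K ⊗[K] MvPolynomial (Fin d) K :=
    (MvPolynomial.sumAlgEquiv K (Fin d) (Fin d)).trans
      ((MvPolynomial.algebraTensorAlgEquiv (σ := Fin d) K (MvPolynomial (Fin d) K)).symm.restrictScalars K)
  let e' : MvPolynomial (Fin (d + d)) K ≃ₐ[K] MvPolynomial (Fin d ⊕ Fin d) K :=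
    MvPolynomial.renameEquiv K finSumFinEquiv.symm
  let G : MvPolynomial (Fin d) K ⊗[K] MvPolynomial (Fin d) K →ₐ[K] R ⊗[K] R := Algebra.TensorProduct.map g g
  have hG : Function.Injective G :=
    TensorProduct.map_injective_of_flat_flat g.toLinearMap g.toLinearMap hg hg
  have := td_le_of_injective (K := K) (trdeg_lt K _) (G.comp (e'.trans e).toAlgHom) (hG.comp (e'.trans e).injective)
  rwa [td_mvPolynomial] at this

end P13
end GK

namespace GK
section P14

/-- `a ⊗ b ↦ a * σ b`. -/
def piMap {K R G : Type*} [Field K] [CommRing R] [Algebra K R] [Group G] (φ : G →* (R ≃ₐ[K] R)) (σ : G) :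
    R ⊗[K] R →ₐ[K] R :=
  Algebra.TensorProduct.productMap (AlgHom.id K R) (φ σ).toAlgHom

theorem piMap_tmul {K R G : Type*} [Field K] [CommRing R] [Algebra K R] [Group G] (φ : G →* (R ≃ₐ[K] R)) (σ : G)
    (a b : R) : piMap φ σ (a ⊗ₜ[K] b) = a * φ σ b := by
  simp [piMap]

theorem piMap_surj {K R G : Type*} [Field K] [CommRing R] [Algebra K R] [Group G] (φ : G →* (R ≃ₐ[K] R)) (σ : G) :
    Function.Surjective (piMap φ σ) := fun a => ⟨a ⊗ₜ 1, by rw [piMap_tmul]; simp⟩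

/-- The ideal of the graph of `σ`. -/
def grI {K R G : Type*} [Field K] [CommRing R] [Algebra K R] [Group G] (φ : G →* (R ≃ₐ[K] R)) (σ : G) :
    Ideal (R ⊗[K] R) := RingHom.ker (piMap φ σ)

theorem grI_prime {K R G : Type*} [Field K] [CommRing R] [IsDomain R] [Algebra K R] [Group G]
    (φ : G →* (R ≃ₐ[K] R)) (σ : G) : (grI φ σ).IsPrime := RingHom.ker_isPrime _

theorem orbit {K R G : Type*} [Field K] [CommRing R] [Algebra K R] [Group G] [Finite G]
    (φ : G →* (R ≃ₐ[K] R)) (x y : R →ₐ[K] K) (h : ∀ f ∈ invariantsAlg K R G φ, x f = y f) :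
    ∃ σ, ∀ f, y f = x (φ σ f) := by
  classical
  have := Fintype.ofFinite G
  have key : ∃ σ ∈ (Finset.univ : Finset G), RingHom.ker y ≤ RingHom.ker (x.comp (φ σ).toAlgHom) := by
    refine (Ideal.subset_union_prime 1 1 (fun σ _ _ _ => RingHom.ker_isPrime _)).mp ?_
    intro f hf
    by_contra hn
    simp only [Finset.coe_univ, Set.mem_univ, Set.iUnion_true, Set.mem_iUnion, not_exists] at hn
    have hN : ∏ σ : G, φ σ f ∈ invariantsAlg K R G φ := by
      intro τ
      rw [map_prod]
      refine Fintype.prod_equiv (Equiv.mulLeft τ) _ _ (fun σ => ?_)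
      simp
    have h1 := h _ hN
    rw [map_prod, map_prod] at h1
    have h2 : ∏ σ : G, y (φ σ f) = 0 := by
      refine Finset.prod_eq_zero (Finset.mem_univ 1) ?_
      rw [map_one]
      exact hf
    rw [h2] at h1
    obtain ⟨σ, -, hσ⟩ := Finset.prod_eq_zero_iff.mp h1
    exact hn σ hσ
  obtain ⟨σ, -, hσ⟩ := key
  refine ⟨σ, fun f => ?_⟩
  have h1 : f - algebraMap K R (y f) ∈ RingHom.ker y := by
    rw [RingHom.mem_ker]; simp
  have h2 := hσ h1
  rw [RingHom.mem_ker] at h2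
  simp only [map_sub, AlgHom.commutes] at h2
  simp [sub_eq_zero] at h2
  exact h2.symm

theorem prime_contains {K R G : Type*} [Field K] [IsAlgClosed K] [CommRing R] [Algebra K R] [Group G] [Finite G]
    (hfg : Algebra.FiniteType K R) (φ : G →* (R ≃ₐ[K] R)) (S0 : Set R) (hS0 : IsSeparating K R G φ S0)
    (q : Ideal (R ⊗[K] R)) [hq : q.IsPrime] (h : ∀ s ∈ S0, deltaMap K R s ∈ q) : ∃ σ, grI φ σ ≤ q := by
  classical
  have := Fintype.ofFinite G
  by_contra hn
  push Not at hn
  have hn' : ∀ σ, ∃ a, a ∈ grI φ σ ∧ a ∉ q := fun σ => Set.not_subset.mp (hn σ)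
  choose a ha haq using hn'
  have hprod : ∏ σ, a σ ∉ q := by
    intro hp
    obtain ⟨σ, -, hσ⟩ := (hq.prod_mem_iff).mp hp
    exact haq σ hσ
  obtain ⟨w, hqw, hw⟩ := exists_point (tensor_ft hfg) q _ hprod
  let x : R →ₐ[K] K := w.comp Algebra.TensorProduct.includeLeft
  let y : R →ₐ[K] K := w.comp Algebra.TensorProduct.includeRight
  have hag : ∀ f ∈ invariantsAlg K R G φ, x f = y f := by
    intro f hf
    by_contra hne
    obtain ⟨s, hs, hs2⟩ := hS0.2 x y ⟨f, hf, hne⟩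
    have h1 : w (deltaMap K R s) = 0 := hqw (h s hs)
    rw [deltaMap, map_sub, sub_eq_zero] at h1
    exact hs2 h1
  obtain ⟨σ, hσ⟩ := orbit φ x y hag
  have hwx : w = x.comp (piMap φ σ) := by
    apply Algebra.TensorProduct.ext
    · ext b
      change x b = x (piMap φ σ (b ⊗ₜ 1))
      rw [piMap_tmul, map_one, mul_one]
    · ext b
      change y b = x (piMap φ σ (1 ⊗ₜ b))
      rw [piMap_tmul, one_mul, hσ]
  apply hw
  rw [map_prod]
  refine Finset.prod_eq_zero (Finset.mem_univ σ) ?_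
  rw [hwx]
  change x (piMap φ σ (a σ)) = 0
  rw [show piMap φ σ (a σ) = 0 from ha σ, map_zero]

theorem lemX {K R G : Type*} [Field K] [CommRing R] [IsDomain R] [Algebra K R] [Group G]
    (hfg : Algebra.FiniteType K R) (φ : G →* (R ≃ₐ[K] R)) (k : ℕ) (σ ρ : G)
    (h : ¬ IsKReflection K R G φ (k : ℕ∞) (ρ * σ⁻¹)) (q : Ideal (R ⊗[K] R)) [hq : q.IsPrime]
    (h1 : grI φ σ ≤ q) (h2 : grI φ ρ ≤ q) : td K ((R ⊗[K] R) ⧸ q) + k + 1 ≤ td K R := by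
  have hs := piMap_surj φ σ
  have hP : (q.map (piMap φ σ)).IsPrime := Ideal.map_isPrime_of_surjective hs h1
  have hcm : (q.map (piMap φ σ)).comap (piMap φ σ) = q := by
    rw [Ideal.comap_map_of_surjective' _ hs, sup_eq_left]; exact h1
  have e := td_quot_comap (piMap φ σ) (q.map (piMap φ σ)) (RingHom.isIntegral_of_surjective _
    (Ideal.Quotient.mk_surjective.comp hs))
  rw [hcm] at e
  rw [e]
  refine nonrefl hfg φ k (ρ * σ⁻¹) h _ (fun c => ?_)
  have h3 : φ ρ (φ σ⁻¹ c) ⊗ₜ[K] (1 : R) - (1 : R) ⊗ₜ[K] (φ σ⁻¹ c) ∈ grI φ ρ := by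
    rw [grI, RingHom.mem_ker, map_sub, piMap_tmul, piMap_tmul]; simp
  have h4 := Ideal.mem_map_of_mem (piMap φ σ) (h2 h3)
  rw [map_sub, piMap_tmul, piMap_tmul, map_one, mul_one, one_mul] at h4
  have h5 : φ σ (φ σ⁻¹ c) = c := by
    rw [← AlgEquiv.mul_apply, ← map_mul]; simp
  rw [h5] at h4
  rw [map_mul, AlgEquiv.mul_apply]
  exact h4

theorem td_gr {K R G : Type*} [Field K] [CommRing R] [IsDomain R] [Algebra K R] [Group G]
    (φ : G →* (R ≃ₐ[K] R)) (σ : G) : td K ((R ⊗[K] R) ⧸ grI φ σ) = td K R :=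
  td_eq_of_isIntegral (Ideal.kerLiftAlg (piMap φ σ)) (Ideal.kerLiftAlg_injective _)
    (RingHom.isIntegral_of_surjective _ (fun a => by
      obtain ⟨b, hb⟩ := piMap_surj φ σ a
      exact ⟨Ideal.Quotient.mk _ b, hb⟩))

theorem gr_le {K R G : Type*} [Field K] [CommRing R] [IsDomain R] [Algebra K R] [Group G]
    (hfg : Algebra.FiniteType K R) (φ : G →* (R ≃ₐ[K] R)) (k : ℕ) (σ ρ : G)
    (h : grI φ ρ ≤ grI φ σ) : IsKReflection K R G φ (k : ℕ∞) (ρ * σ⁻¹) := by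
  by_contra hn
  have := grI_prime φ σ
  have h1 := lemX hfg φ k σ ρ hn (grI φ σ) le_rfl h
  rw [td_gr] at h1
  omega

theorem delta_mem {K R G : Type*} [Field K] [CommRing R] [IsDomain R] [Algebra K R] [Group G]
    (φ : G →* (R ≃ₐ[K] R)) (σ : G) (f : R) (hf : f ∈ invariantsAlg K R G φ) : deltaMap K R f ∈ grI φ σ := by
  rw [grI, RingHom.mem_ker, deltaMap, map_sub, piMap_tmul, piMap_tmul, hf σ]; simp

theorem exists_sep {K R G : Type*} [Field K] [CommRing R] [Algebra K R] [Group G]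
    (φ : G →* (R ≃ₐ[K] R)) (m : ℕ) (h : gammaSep K R G φ = (m : ℕ∞)) :
    ∃ l : List R, l.length ≤ m ∧ IsSeparating K R G φ {x | x ∈ l} := by
  have h1 : gammaSep K R G φ < ((m + 1 : ℕ) : ℕ∞) := by
    rw [h]; exact_mod_cast Nat.lt_succ_self m
  rw [gammaSep, iInf_lt_iff] at h1
  obtain ⟨S, hS⟩ := h1
  rw [iInf_lt_iff] at hS
  obtain ⟨hsep, hc⟩ := hS
  have hfin : S.Finite := Set.encard_lt_top_iff.mp (hc.trans (ENat.natCast_lt_top _))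
  refine ⟨hfin.toFinset.toList, ?_, ?_⟩
  · rw [Finset.length_toList]
    rw [hfin.encard_eq_coe_toFinset_card] at hc
    have : hfin.toFinset.card < m + 1 := by exact_mod_cast hc
    omega
  · have : {x | x ∈ hfin.toFinset.toList} = S := by ext; simp
    rw [this]; exact hsep

theorem main {K R G : Type*} [Field K] [IsAlgClosed K] [CommRing R] [IsDomain R]
    [IsIntegrallyClosed R] [Algebra K R] [Group G] [Finite G] (hfg : Algebra.FiniteType K R)
    (φ : G →* (R ≃ₐ[K] R))
    (hgen : Subgroup.closure {σ : G | HasFixedPoint K R G φ σ} = ⊤)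
    (n k : ℕ) (hk : 1 ≤ k) (hn : ringKrullDim R = (n : WithBot ℕ∞))
    (hsep : gammaSep K R G φ = ((n + k - 1 : ℕ) : ℕ∞)) :
    Subgroup.closure {σ : G | IsKReflection K R G φ (k : ℕ∞) σ} = ⊤ := by
  classical
  have := Fintype.ofFinite G
  by_contra hne
  obtain ⟨N, hN⟩ : ∃ N, N = Subgroup.closure {σ : G | IsKReflection K R G φ (k : ℕ∞) σ} := ⟨_, rfl⟩
  have hNr : ∀ σ, σ ∉ N → ¬ IsKReflection K R G φ (k : ℕ∞) σ := by
    intro σ hσ h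
    rw [hN] at hσ
    exact hσ (Subgroup.subset_closure h)
  rw [← hN] at hne
  have hτ : ∃ τ, HasFixedPoint K R G φ τ ∧ τ ∉ N := by
    by_contra hc
    push Not at hc
    apply hne
    rw [eq_top_iff, ← hgen, Subgroup.closure_le]
    exact hc
  obtain ⟨τ, ⟨x, hx⟩, hτN⟩ := hτ
  obtain ⟨l, hl, hS0⟩ := exists_sep φ _ hsep
  have hdim := dim_le_td (K := K) hfg n hn
  have hSd : IsDomain (R ⊗[K] R) := tensor_domain hfg
  have hSn : IsIntegrallyClosed (R ⊗[K] R) := tensor_normal hfg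
  have hSft := tensor_ft hfg
  have htt := td_tensor hfg
  have hnoeth : IsNoetherianRing (R ⊗[K] R) := Algebra.FiniteType.isNoetherianRing K _
  obtain ⟨A, _, _, g, hg, hgi, hgood⟩ := exists_good hSft
  have hAd : IsDomain A := hgood.dom
  let w : R ⊗[K] R →ₐ[K] K := x.comp (piMap φ 1)
  have hm1 : grI φ 1 ≤ RingHom.ker w := by
    intro a ha
    rw [RingHom.mem_ker]
    change x (piMap φ 1 a) = 0
    rw [show piMap φ 1 a = 0 from ha, map_zero]
  have hwτ : w = x.comp (piMap φ τ) := by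
    apply Algebra.TensorProduct.ext
    · ext b
      change x (piMap φ 1 (b ⊗ₜ 1)) = x (piMap φ τ (b ⊗ₜ 1))
      rw [piMap_tmul, piMap_tmul, map_one, map_one]
    · ext b
      change x (piMap φ 1 (1 ⊗ₜ b)) = x (piMap φ τ (1 ⊗ₜ b))
      rw [piMap_tmul, piMap_tmul, one_mul, one_mul, hx, map_one]; rfl
  have hmτ : grI φ τ ≤ RingHom.ker w := by
    intro a ha
    rw [RingHom.mem_ker, hwτ]
    change x (piMap φ τ a) = 0
    rw [show piMap φ τ a = 0 from ha, map_zero]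
  have hmp : (RingHom.ker w).IsPrime := RingHom.ker_isPrime _
  obtain ⟨𝔫, h𝔫, -, h𝔫c⟩ := lying_over_quot g.toRingHom ⊥ (isIntegral_mk_comp g.toRingHom hgi ⊥) (RingHom.ker w)
    (by
      intro a ha
      have h0 : g a = 0 := ha
      rw [(map_eq_zero_iff g hg).mp h0]
      exact zero_mem _)
  let fs : List A := l.map (fun s => g (deltaMap K R s))
  have hfs : ∀ q : Ideal A, (∀ f ∈ fs, f ∈ q) ↔ ∀ s ∈ l, deltaMap K R s ∈ q.comap g := by
    intro q; simp [fs]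
  let I0 : Ideal (R ⊗[K] R) := ∏ σ ∈ Finset.univ.filter (fun σ => σ ∈ N), grI φ σ
  let J0 : Ideal (R ⊗[K] R) := ∏ σ ∈ Finset.univ.filter (fun σ => σ ∉ N), grI φ σ
  have hI0 : ∀ q : Ideal (R ⊗[K] R), q.IsPrime → (I0 ≤ q ↔ ∃ σ ∈ N, grI φ σ ≤ q) := by
    intro q hq
    rw [Ideal.IsPrime.prod_le hq]; simp
  have hJ0 : ∀ q : Ideal (R ⊗[K] R), q.IsPrime → (J0 ≤ q ↔ ∃ σ ∉ N, grI φ σ ≤ q) := by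
    intro q hq
    rw [Ideal.IsPrime.prod_le hq]; simp
  have hSR := SR fs.length hgood 𝔫 fs rfl (I0.map g) (J0.map g)
    (Ideal.FG.map (hnoeth.noetherian I0) g.toRingHom) (Ideal.FG.map (hnoeth.noetherian J0) g.toRingHom)
    (by
      intro q hq _ hf
      have hqc : (q.comap g).IsPrime := Ideal.comap_isPrime g q
      rw [Ideal.map_le_iff_le_comap, Ideal.map_le_iff_le_comap, hI0 _ hqc, hJ0 _ hqc]
      obtain ⟨σ, hσ⟩ := prime_contains hfg φ _ hS0 (q.comap g) ((hfs q).mp hf)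
      by_cases h : σ ∈ N
      · exact Or.inl ⟨σ, h, hσ⟩
      · exact Or.inr ⟨σ, h, hσ⟩)
    (by
      intro q hq _ hf hI hJ
      have hqc : (q.comap g).IsPrime := Ideal.comap_isPrime g q
      rw [Ideal.map_le_iff_le_comap, hI0 _ hqc] at hI
      rw [Ideal.map_le_iff_le_comap, hJ0 _ hqc] at hJ
      obtain ⟨σ, hσN, hσ⟩ := hI
      obtain ⟨ρ, hρN, hρ⟩ := hJ
      have h1 := lemX hfg φ k σ ρ (hNr _ (fun h => hρN (by simpa using N.mul_mem h hσN))) (q.comap g) hσ hρ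
      rw [td_quot_comap g q (isIntegral_mk_comp g.toRingHom hgi q)] at h1
      have h2 : fs.length = l.length := by simp [fs]
      omega)
  have gd : ∀ σ, grI φ σ ≤ RingHom.ker w → ∃ q : Ideal A, q.IsPrime ∧ q ≤ 𝔫 ∧ (∀ f ∈ fs, f ∈ q) ∧ q.comap g = grI φ σ := by
    intro σ hσ
    have := grI_prime φ σ
    obtain ⟨q, hqn, hq, hqc⟩ := going_down_int g.toRingHom hg hgi (grI φ σ) 𝔫 (by rw [h𝔫c]; exact hσ)
    have hqc' : q.comap g = grI φ σ := hqc
    refine ⟨q, hq, hqn, ?_, hqc'⟩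
    rw [hfs, hqc']
    intro s hs
    exact delta_mem φ σ s (hS0.1 hs)
  rcases hSR with h | h
  · obtain ⟨q, hq, hqn, hqf, hqc⟩ := gd τ hmτ
    have h1 := h q hq hqn hqf
    rw [Ideal.map_le_iff_le_comap, hqc, hI0 _ (grI_prime φ τ)] at h1
    obtain ⟨σ, hσN, hσ⟩ := h1
    refine hNr (σ * τ⁻¹) (fun h => hτN ?_) (gr_le hfg φ k τ σ hσ)
    have := N.mul_mem (N.inv_mem h) hσN
    simpa using this
  · obtain ⟨q, hq, hqn, hqf, hqc⟩ := gd 1 hm1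
    have h1 := h q hq hqn hqf
    rw [Ideal.map_le_iff_le_comap, hqc, hJ0 _ (grI_prime φ 1)] at h1
    obtain ⟨σ, hσN, hσ⟩ := h1
    refine hNr (σ * 1⁻¹) (by simpa using hσN) (gr_le hfg φ k 1 σ hσ)

end P14
end GK

section Statements

variable {K R G : Type*} [Field K] [IsAlgClosed K] [CommRing R] [IsDomain R]
  [IsIntegrallyClosed R] [Algebra K R] [Group G] [Finite G]

/-- If the n-dimensional affine G-variety X is normal and connected,
G is generated by elements having a fixed point in X, and γ_sep = n + k - 1 with k ≥ 1,
then G is generated by k-reflections. -/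
theorem generated_by_kReflections_of_gammaSep (hfg : Algebra.FiniteType K R)
    (φ : G →* (R ≃ₐ[K] R))
    (hgen : Subgroup.closure {σ : G | HasFixedPoint K R G φ σ} = ⊤)
    (n k : ℕ) (hk : 1 ≤ k) (hn : ringKrullDim R = (n : WithBot ℕ∞))
    (hsep : gammaSep K R G φ = ((n + k - 1 : ℕ) : ℕ∞)) :
    Subgroup.closure {σ : G | IsKReflection K R G φ (k : ℕ∞) σ} = ⊤ := by
  exact GK.main hfg φ hgen n k hk hn hsep

end Statements
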